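/- Suppose there exists a σ-field 𝒳 ⊆ ℬ such that: (1) 𝒳 ⊆ T^{−1}𝒳; (2) ess sup_{u ∈ 𝕌_0} |E[ℓ_0(u) | 𝒴_{−∞,0} ∨ T^{−n}𝒳] − ℓ_0(u)| → 0 in L¹(P), ess sup_{u ∈ 𝕌_0} |E[ℓ_0(u) | 𝒴_{−∞,0} ∨ T^{n}𝒳] − E[ℓ_0(u) | ⋂_{k=1}^∞ (𝒴_{−∞,0} ∨ T^{k}𝒳)]| → 0 in L¹(P), and ess sup_{u ∈ 𝕌_{−n,0}} |E[ℓ_0(u) | 𝒴_{−n,0}] − E[ℓ_0(u) | 𝒴_{−∞,0}]| → 0 almost surely, as n → ∞; (3) for every u ∈ 𝕌_0, E[ℓ_0(u) | 𝒴_{−∞,0}] = E[ℓ_0(u) | ⋂_{k=1}^∞ (𝒴_{−∞,0} ∨ T^{k}𝒳)] almost surely. Then every mean-optimal strategy ũ satisfies L_T(ũ) → L* := E[ess inf_{u ∈ 𝕌_0} E[ℓ_0(u) | 𝒴_{−∞,0}]] almost surely as T → ∞, and ũ is pathwise optimal: liminf_{T→∞} (L_T(u) − L_T(ũ)) ≥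 0 a.s. for every admissible strategy u. -/

import Mathlib

open MeasureTheory Filter Set
open scoped ENNReal Topology symmDiff

noncomputable section

namespace ErgodicDecisions

variable {Ω U : Type*}

/-- The `ℤ`-indexed iterates of an invertible transformation `T` with inverse `S`:
`iter T S n = Tⁿ` for `n ≥ 0` and `iter T S (-n) = Sⁿ`. -/
def iter (T S : Ω → Ω) : ℤ → Ω → Ω
  | Int.ofNat n => T^[n]
  | Int.negSucc n => S^[n + 1]

variable {m0 : MeasurableSpace Ω} [mU : MeasurableSpace U]

/-- The observation σ-field `𝒴_{m,n} = ⋁_{k=m}^{n} T^{-k} 𝒴`. -/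
def obsField (T S : Ω → Ω) (Y : MeasurableSpace Ω) (m n : ℤ) : MeasurableSpace Ω :=
  ⨆ k ∈ Set.Icc m n, MeasurableSpace.comap (iter T S k) Y

/-- The observation σ-field `𝒴_{-∞,n} = ⋁_{k ≤ n} T^{-k} 𝒴`. -/
def obsFieldLE (T S : Ω → Ω) (Y : MeasurableSpace Ω) (n : ℤ) : MeasurableSpace Ω :=
  ⨆ k ∈ Set.Iic n, MeasurableSpace.comap (iter T S k) Y

/-- `𝕌_{m,n}`: the set of `𝒴_{m,n}`-measurable decision maps `Ω → U`. -/
def Umn (T S : Ω → Ω) (Y : MeasurableSpace Ω) (m n : ℤ) : Set (Ω → U) :=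
  {v | Measurable[obsField T S Y m n] v}

/-- `𝕌_n = ⋃_{m ≤ n} 𝕌_{m,n}`. -/
def Un (T S : Ω → Ω) (Y : MeasurableSpace Ω) (n : ℤ) : Set (Ω → U) :=
  ⋃ m ∈ Set.Iic n, Umn T S Y m n

/-- The loss at time `n` of the decision map `v`: `ℓ_n(v)(ω) = ℓ(v(ω), Tⁿω)`. -/
def lossAt (T S : Ω → Ω) (ℓ : U → Ω → ℝ) (n : ℤ) (v : Ω → U) (ω : Ω) : ℝ :=
  ℓ (v ω) (iter T S n ω)

/-- An admissible strategy: `u_k` is `𝒴_{0,k}`-measurable for every `k ≥ 1`. -/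
def Admissible (T S : Ω → Ω) (Y : MeasurableSpace Ω) (u : ℕ → Ω → U) : Prop :=
  ∀ k : ℕ, 1 ≤ k → u k ∈ Umn T S Y 0 (k : ℤ)

/-- The time-average loss `L_T(u) = T⁻¹ ∑_{k=1}^T ℓ_k(u_k)`. -/
def avgLoss (T S : Ω → Ω) (ℓ : U → Ω → ℝ) (u : ℕ → Ω → U) (n : ℕ) (ω : Ω) : ℝ :=
  (n : ℝ)⁻¹ * ∑ k ∈ Finset.Icc 1 n, lossAt T S ℓ (k : ℤ) (u k) ω

/-- `g` is an essential infimum (an a.e.-greatest lower bound among random variables)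
of the family `(f i)_{i ∈ S₀}` under `P`. -/
def IsEssInfFam {ι : Type*} (P : Measure Ω) (S₀ : Set ι) (f : ι → Ω → ℝ) (g : Ω → ℝ) : Prop :=
  Measurable[m0] g ∧ (∀ i ∈ S₀, ∀ᵐ ω ∂P, g ω ≤ f i ω) ∧
    ∀ h : Ω → ℝ, Measurable[m0] h → (∀ i ∈ S₀, ∀ᵐ ω ∂P, h ω ≤ f i ω) → ∀ᵐ ω ∂P, h ω ≤ g ω

/-- `g` is an essential supremum (an a.e.-least upper bound among random variables)
of the family `(f i)_{i ∈ S₀}` under `P`. -/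
def IsEssSupFam {ι : Type*} (P : Measure Ω) (S₀ : Set ι) (f : ι → Ω → ℝ) (g : Ω → ℝ) : Prop :=
  Measurable[m0] g ∧ (∀ i ∈ S₀, ∀ᵐ ω ∂P, f i ω ≤ g ω) ∧
    ∀ h : Ω → ℝ, Measurable[m0] h → (∀ i ∈ S₀, ∀ᵐ ω ∂P, f i ω ≤ h ω) → ∀ᵐ ω ∂P, g ω ≤ h ω

/-- A mean-optimal strategy in the sense of Lemma 2.5 of the paper:
`E[ℓ_k(ũ_k)|𝒴_{0,k}] ≤ ess inf_{u ∈ 𝕌_{0,k}} E[ℓ_k(u)|𝒴_{0,k}] + 1/k` a.s. for all `k ≥ 1`. -/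
def MeanOptimalStrategy (P : Measure Ω) (T S : Ω → Ω) (Y : MeasurableSpace Ω)
    (ℓ : U → Ω → ℝ) (ut : ℕ → Ω → U) : Prop :=
  Admissible T S Y ut ∧
    ∀ k : ℕ, 1 ≤ k → ∃ g : Ω → ℝ,
      IsEssInfFam P (Umn T S Y 0 (k : ℤ))
        (fun v => P[lossAt T S ℓ (k : ℤ) v | obsField T S Y 0 (k : ℤ)]) g ∧
      ∀ᵐ ω ∂P, (P[lossAt T S ℓ (k : ℤ) (ut k) | obsField T S Y 0 (k : ℤ)]) ω ≤ g ω + (k : ℝ)⁻¹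

/-- Pathwise optimality (Definition 2.2). -/
def PathwiseOptimal (P : Measure Ω) (T S : Ω → Ω) (Y : MeasurableSpace Ω)
    (ℓ : U → Ω → ℝ) (us : ℕ → Ω → U) : Prop :=
  Admissible T S Y us ∧
    ∀ u : ℕ → Ω → U, Admissible T S Y u →
      ∀ᵐ ω ∂P,
        0 ≤ Filter.liminf (fun n : ℕ => avgLoss T S ℓ u n ω - avgLoss T S ℓ us n ω) atTop

/-- Weak pathwise optimality (Definition 2.3). -/
def WeaklyPathwiseOptimal (P : Measure Ω) (T S : Ω → Ω) (Y : MeasurableSpace Ω)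
    (ℓ : U → Ω → ℝ) (us : ℕ → Ω → U) : Prop :=
  Admissible T S Y us ∧
    ∀ u : ℕ → Ω → U, Admissible T S Y u → ∀ ε : ℝ, 0 < ε →
      Tendsto (fun n : ℕ => P {ω | -ε ≤ avgLoss T S ℓ u n ω - avgLoss T S ℓ us n ω})
        atTop (𝓝 1)

/-- Mean optimality (Definition 2.4). -/
def MeanOptimal (P : Measure Ω) (T S : Ω → Ω) (Y : MeasurableSpace Ω)
    (ℓ : U → Ω → ℝ) (us : ℕ → Ω → U) : Prop :=
  Admissible T S Y us ∧
    ∀ u : ℕ → Ω → U, Admissible T S Y u →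
      0 ≤ Filter.liminf
        (fun n : ℕ => (∫ ω, avgLoss T S ℓ u n ω ∂P) - ∫ ω, avgLoss T S ℓ us n ω ∂P) atTop

/-- Two σ-fields on `Ω` agree modulo `P`-null sets. -/
def EqModP (P : Measure Ω) (m₁ m₂ : MeasurableSpace Ω) : Prop :=
  (∀ A : Set Ω, MeasurableSet[m₁] A → ∃ B : Set Ω, MeasurableSet[m₂] B ∧ P (A ∆ B) = 0) ∧
    ∀ A : Set Ω, MeasurableSet[m₂] A → ∃ B : Set Ω, MeasurableSet[m₁] B ∧ P (A ∆ B) = 0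

/-- Conditional K-automorphism relative to `Z` (Definition 1.4); `S` is the inverse of `T`,
so that `T^{-k}𝒳 = comap T^k 𝒳` and `T^{k}𝒳 = comap S^k 𝒳`. -/
def CondK (P : Measure Ω) (T S : Ω → Ω) (Z : MeasurableSpace Ω) : Prop :=
  ∃ X : MeasurableSpace Ω, X ≤ m0 ∧
    X ≤ MeasurableSpace.comap T X ∧
    EqModP P (⨆ k : ℕ, MeasurableSpace.comap (T^[k + 1]) X) m0 ∧
    EqModP P (⨅ k : ℕ, Z ⊔ MeasurableSpace.comap (S^[k + 1]) X) Z

/-- Conditional weak mixing relative to `Z` (Definition 1.3); `S` is the inverse of `T`,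
so that `T^k B = (S^[k])⁻¹ B`. -/
def CondWeakMixing (P : Measure Ω) (S : Ω → Ω) (Z : MeasurableSpace Ω) : Prop :=
  ∀ A B : Set Ω, MeasurableSet[m0] A → MeasurableSet[m0] B →
    Tendsto
      (fun n : ℕ => ∫ ω,
        (n : ℝ)⁻¹ * ∑ k ∈ Finset.Icc 1 n,
          |(P[(A ∩ S^[k] ⁻¹' B).indicator (fun _ => (1 : ℝ)) | Z]) ω -
            (P[A.indicator (fun _ => (1 : ℝ)) | Z]) ω *
              (P[(S^[k] ⁻¹' B).indicator (fun _ => (1 : ℝ)) | Z]) ω| ∂P)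
      atTop (𝓝 0)

/-- The tail σ-field `⋂_{k≥1} (𝒴_{-∞,0} ∨ T^k 𝒳)`. -/
def tailField (T S : Ω → Ω) (Y X : MeasurableSpace Ω) : MeasurableSpace Ω :=
  ⨅ k : ℕ, obsFieldLE T S Y 0 ⊔ MeasurableSpace.comap (S^[k + 1]) X

/-- The truncated loss `ℓ_0(v)·1_{Λ ≤ M}`. -/
def truncLoss (ℓ : U → Ω → ℝ) (Λ : Ω → ℝ) (M : ℝ) (v : Ω → U) (ω : Ω) : ℝ :=
  if Λ ω ≤ M then ℓ (v ω) ω else 0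

/-- `ℓ̄_0^M(v) = ℓ_0(v)·1_{Λ≤M} − E[ℓ_0(v)·1_{Λ≤M} | 𝒴_{-∞,0}]`. -/
def barLoss (P : Measure Ω) (T S : Ω → Ω) (Y : MeasurableSpace Ω)
    (ℓ : U → Ω → ℝ) (Λ : Ω → ℝ) (M : ℝ) (v : Ω → U) (ω : Ω) : ℝ :=
  truncLoss ℓ Λ M v ω - (P[truncLoss ℓ Λ M v | obsFieldLE T S Y 0]) ω

/-- The uniform conditional mixing assumption of Theorem 2.12:
`lim_{M→∞} limsup_{T→∞} E[(1/T)∑_{k=1}^T ess sup_{u,u'∈𝕌₀}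
|E[(ℓ̄₀^M(u)∘T^{-k})·ℓ̄₀^M(u')|𝒴_{-∞,0}]|] = 0`. -/
def UniformCondMixing (P : Measure Ω) (T S : Ω → Ω) (Y : MeasurableSpace Ω)
    (ℓ : U → Ω → ℝ) (Λ : Ω → ℝ) : Prop :=
  ∃ G : ℝ → ℕ → Ω → ℝ,
    (∀ (M : ℝ) (k : ℕ),
      IsEssSupFam P ((Un T S Y 0) ×ˢ (Un T S Y 0))
        (fun p ω =>
          |(P[(fun ω' => barLoss P T S Y ℓ Λ M p.1 (S^[k] ω') *
                barLoss P T S Y ℓ Λ M p.2 ω') | obsFieldLE T S Y 0]) ω|)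
        (G M k)) ∧
    Tendsto
      (fun M : ℝ =>
        Filter.limsup
          (fun n : ℕ => ∫ ω, (n : ℝ)⁻¹ * ∑ k ∈ Finset.Icc 1 n, G M k ω ∂P) atTop)
      atTop (𝓝 0)

/-- Equimeasurability of the loss (Definition 3.1): for every `ε > 0` there is a set of
probability at least `1-ε` on which the family `{ℓ(u,·) : u ∈ U}` is totally bounded
in `L^∞(P)`. -/
def Equimeasurable (P : Measure Ω) (ℓ : U → Ω → ℝ) : Prop :=
  ∀ ε : ℝ, 0 < ε → ∃ Ωε : Set Ω, MeasurableSet[m0] Ωε ∧ 1 - ENNReal.ofReal ε ≤ P Ωε ∧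
    ∀ δ : ℝ, 0 < δ → ∃ 𝒩 : Finset (Ω → ℝ), ∀ u : U, ∃ f ∈ 𝒩,
      eLpNorm (fun ω => Ωε.indicator (ℓ u) ω - f ω) ⊤ P ≤ ENNReal.ofReal δ


theorem birk_bdd {Ω : Type*} [m0 : MeasurableSpace Ω] {P : Measure Ω} [IsProbabilityMeasure P]
    {T : Ω → Ω} (hT : Ergodic T P) {f : Ω → ℝ} (hfm : Measurable f) (hf : Integrable f P)
    (hneg : ∫ ω, f ω ∂P < 0) :
    ∀ᵐ ω ∂P, ∃ B : ℝ, ∀ n : ℕ, ∑ i ∈ Finset.range n, f (T^[i] ω) ≤ B := by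
  let M : ℕ → Ω → ℝ := fun n => Nat.rec (fun _ => 0) (fun _ Mn ω => max 0 (f ω + Mn (T ω))) n
  have hM0 : ∀ ω, M 0 ω = 0 := fun _ => rfl
  have hMs : ∀ n ω, M (n+1) ω = max 0 (f ω + M n (T ω)) := fun _ _ => rfl
  have hTm : Measurable T := hT.measurable
  have hMm : ∀ n, Measurable (M n) := by
    intro n
    induction n with
    | zero => exact measurable_const
    | succ n ih => exact measurable_const.max (hfm.add (ih.comp hTm))
  have hMi : ∀ n, Integrable (M n) P := by
    intro n
    induction n with
    | zero => exact integrable_const 0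
    | succ n ih =>
      exact (integrable_const (0:ℝ)).sup
        (hf.add (hT.toMeasurePreserving.integrable_comp_of_integrable ih))
  have hMnn : ∀ n ω, 0 ≤ M n ω := by
    intro n ω
    cases n with
    | zero => exact le_rfl
    | succ n => exact le_max_left _ _
  have hMmono1 : ∀ n ω, M n ω ≤ M (n+1) ω := by
    intro n
    induction n with
    | zero => intro ω; exact hMnn 1 ω
    | succ n ih =>
      intro ω
      rw [hMs, hMs (n+1)]
      exact max_le_max le_rfl (by linarith [ih (T ω)])
  have hMmono : ∀ ω, Monotone (fun n => M n ω) := fun ω => monotone_nat_of_le_succ (fun n => hMmono1 n ω)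
  have hSM : ∀ n ω, ∑ i ∈ Finset.range n, f (T^[i] ω) ≤ M n ω := by
    intro n
    induction n with
    | zero => intro ω; simp [hM0]
    | succ n ih =>
      intro ω
      rw [Finset.sum_range_succ', hMs]
      refine le_trans ?_ (le_max_right _ _)
      have := ih (T ω)
      simp only [Function.iterate_succ, Function.comp, Function.iterate_zero, id] at this ⊢
      linarith
  let A : Set Ω := {ω | BddAbove (Set.range fun n => M n ω)}
  have hAm : MeasurableSet A := measurableSet_bddAbove_range hMm
  have hAinv : T ⁻¹' A = A := by
    ext ω
    constructor
    · rintro ⟨B, hB⟩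
      refine ⟨max 0 (f ω + B), ?_⟩
      rintro _ ⟨n, rfl⟩
      refine (hMmono1 n ω).trans ?_
      rw [hMs]
      exact max_le_max le_rfl (by have := hB ⟨n, rfl⟩; simp only at this; linarith)
    · rintro ⟨B, hB⟩
      refine ⟨B - f ω, ?_⟩
      rintro _ ⟨n, rfl⟩
      have h1 := hB ⟨n+1, rfl⟩
      simp only [hMs] at h1
      have := (le_max_right _ _).trans h1
      simp only
      linarith
  rcases hT.toPreErgodic.ae_mem_or_ae_notMem hAm hAinv with h | h
  · filter_upwards [h] with ω hω
    obtain ⟨B, hB⟩ := hω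
    exact ⟨B, fun n => (hSM n ω).trans (hB ⟨n, rfl⟩)⟩
  · exfalso
    have hlim : Tendsto (fun n => ∫ ω, (M (n+1) ω - M n (T ω)) ∂P) atTop (𝓝 (∫ ω, f ω ∂P)) := by
      refine tendsto_integral_of_dominated_convergence (fun ω => |f ω|) ?_ hf.abs ?_ ?_
      · intro n
        exact ((hMm (n+1)).sub ((hMm n).comp hTm)).aestronglyMeasurable
      · intro n
        refine ae_of_all _ fun ω => ?_
        rw [hMs, Real.norm_eq_abs]
        have h0 := hMnn n (T ω)
        rcases max_cases 0 (f ω + M n (T ω)) with ⟨h1, h2⟩ | ⟨h1, h2⟩ <;> rw [h1]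
        · rw [abs_le]
          constructor
          · have := neg_abs_le (f ω); have := le_abs_self (f ω); have := abs_nonneg (f ω); 
            have : f ω ≤ - M n (T ω) := by linarith
            have : |f ω| = - f ω := abs_of_nonpos (by linarith)
            linarith
          · have := abs_nonneg (f ω); linarith
        · rw [add_sub_cancel_right]
      · filter_upwards [h] with ω hω
        have hω' : T ω ∉ A := fun hc => hω (by rw [← hAinv]; exact hc)
        have htop : Tendsto (fun n => M n (T ω)) atTop atTop :=
          (tendsto_atTop_of_monotone (hMmono (T ω))).resolve_right (by
            rintro ⟨l, hl⟩
            exact hω' hl.bddAbove_range)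
        refine tendsto_const_nhds.congr' ?_
        filter_upwards [htop.eventually_ge_atTop (- f ω)] with n hn
        rw [hMs, max_eq_right (by linarith)]
        ring
    have hge : ∀ n, 0 ≤ ∫ ω, (M (n+1) ω - M n (T ω)) ∂P := by
      intro n
      have hi2 : Integrable (fun ω => M n (T ω)) P :=
        hT.toMeasurePreserving.integrable_comp_of_integrable (hMi n)
      rw [integral_sub (hMi (n+1)) hi2]
      have : ∫ ω, M n (T ω) ∂P = ∫ ω, M n ω ∂P := by
        rw [← integral_map hTm.aemeasurable (by rw [hT.map_eq]; exact (hMi n).1), hT.map_eq]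
      rw [this]
      have := integral_mono (hMi n) (hMi (n+1)) (fun ω => hMmono1 n ω)
      linarith
    have := ge_of_tendsto' hlim hge
    linarith

theorem sum_Icc_range {E : Type*} [AddCommMonoid E] (F : ℕ → E) (n : ℕ) :
    ∑ k ∈ Finset.Icc 1 n, F k = ∑ i ∈ Finset.range n, F (i+1) := by
  rw [Finset.range_eq_Ico, Finset.sum_Ico_add' F 0 n 1]
  rfl

theorem ae_iterate {Ω : Type*} [m0 : MeasurableSpace Ω] {P : Measure Ω}
    {T : Ω → Ω} (hT : MeasurePreserving T P P) {p : ℕ → Ω → Prop} (h : ∀ k, ∀ᵐ ω ∂P, p k ω) :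
    ∀ᵐ ω ∂P, ∀ k, p k (T^[k] ω) := by
  rw [ae_all_iff]
  intro k
  exact (hT.iterate k).quasiMeasurePreserving.ae (h k)

theorem birk_le {Ω : Type*} [m0 : MeasurableSpace Ω] {P : Measure Ω} [IsProbabilityMeasure P]
    {T : Ω → Ω} (hT : Ergodic T P) {f : Ω → ℝ} (hf : Integrable f P) {c : ℝ}
    (hc : ∫ ω, f ω ∂P < c) :
    ∀ᵐ ω ∂P, ∀ᶠ n : ℕ in atTop, (n:ℝ)⁻¹ * ∑ k ∈ Finset.Icc 1 n, f (T^[k] ω) ≤ c := by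
  wlog hfm : Measurable f generalizing f with H
  · have hae : f =ᵐ[P] hf.1.mk f := hf.1.ae_eq_mk
    have h1 := H (f := hf.1.mk f) (hf.congr hae) (by rwa [← integral_congr_ae hae])
      hf.1.stronglyMeasurable_mk.measurable
    filter_upwards [h1, ae_iterate hT.toMeasurePreserving (fun _ => hae)] with ω h1 h2
    filter_upwards [h1] with n hn
    simpa only [h2] using hn
  obtain ⟨c', hc1, hc2⟩ := exists_between hc
  have hTm := hT.measurable
  have hi : Integrable (fun ω => f (T ω)) P := hT.toMeasurePreserving.integrable_comp_of_integrable hf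
  have := birk_bdd hT (f := fun ω => f (T ω) - c') ((hfm.comp hTm).sub_const c')
    (hi.sub (integrable_const c')) (by
      rw [integral_sub hi (integrable_const c')]
      have : ∫ ω, f (T ω) ∂P = ∫ ω, f ω ∂P := by
        rw [← integral_map hTm.aemeasurable (by rw [hT.map_eq]; exact hf.1), hT.map_eq]
      rw [this]
      simp
      linarith)
  filter_upwards [this] with ω ⟨B, hB⟩
  have hlim : Tendsto (fun n : ℕ => c' + B * (n:ℝ)⁻¹) atTop (𝓝 (c' + B * 0)) :=
    (tendsto_natCast_atTop_atTop.inv_tendsto_atTop.const_mul B).const_add c'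
  filter_upwards [hlim.eventually_lt_const (by linarith : c' + B * 0 < c), eventually_gt_atTop 0] with n hn hn0
  refine le_trans ?_ hn.le
  have h1 := hB n
  have hn0' : (0:ℝ) < n := by exact_mod_cast hn0
  rw [sum_Icc_range (fun k => f (T^[k] ω))]
  simp only [Finset.sum_sub_distrib, Finset.sum_const, Finset.card_range, nsmul_eq_mul,
    ← Function.iterate_succ_apply' T] at h1
  rw [inv_mul_le_iff₀ hn0']
  have : (n:ℝ) * (c' + B * (n:ℝ)⁻¹) = n * c' + B := by field_simp
  rw [this]; linarith

theorem birk {Ω : Type*} [m0 : MeasurableSpace Ω] {P : Measure Ω} [IsProbabilityMeasure P]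
    {T : Ω → Ω} (hT : Ergodic T P) {f : Ω → ℝ} (hf : Integrable f P) :
    ∀ᵐ ω ∂P, Tendsto (fun n : ℕ => (n:ℝ)⁻¹ * ∑ k ∈ Finset.Icc 1 n, f (T^[k] ω)) atTop
      (𝓝 (∫ ω, f ω ∂P)) := by
  have h1 : ∀ᵐ ω ∂P, ∀ j : ℕ, ∀ᶠ n : ℕ in atTop,
      (n:ℝ)⁻¹ * ∑ k ∈ Finset.Icc 1 n, f (T^[k] ω) ≤ ∫ ω, f ω ∂P + 1 / ((j:ℝ) + 1) := by
    rw [ae_all_iff]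
    intro j
    have : (0:ℝ) < 1 / ((j:ℝ) + 1) := by positivity
    exact birk_le hT hf (by linarith)
  have h2 : ∀ᵐ ω ∂P, ∀ j : ℕ, ∀ᶠ n : ℕ in atTop,
      (n:ℝ)⁻¹ * ∑ k ∈ Finset.Icc 1 n, (fun ω => - f ω) (T^[k] ω) ≤ ∫ ω, - f ω ∂P + 1 / ((j:ℝ) + 1) := by
    rw [ae_all_iff]
    intro j
    have : (0:ℝ) < 1 / ((j:ℝ) + 1) := by positivity
    exact birk_le hT hf.neg (by simp only [Pi.neg_apply]; linarith)
  filter_upwards [h1, h2] with ω h1 h2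
  rw [Metric.tendsto_nhds]
  intro ε hε
  obtain ⟨j, hj⟩ := exists_nat_one_div_lt hε
  filter_upwards [h1 j, h2 j] with n a b
  simp only [integral_neg, Finset.sum_neg_distrib] at b
  rw [Real.dist_eq, abs_lt]
  constructor <;> linarith

theorem maker {Ω : Type*} [m0 : MeasurableSpace Ω] {P : Measure Ω} [IsProbabilityMeasure P]
    {T : Ω → Ω} (hT : Ergodic T P) {f : ℕ → Ω → ℝ} {g D : Ω → ℝ} (hfm : ∀ k, Measurable (f k))
    (hgm : Measurable g) (hD : Integrable D P) (hfD : ∀ k, ∀ᵐ ω ∂P, |f k ω| ≤ D ω)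
    (hlim : ∀ᵐ ω ∂P, Tendsto (fun k => f k ω) atTop (𝓝 (g ω))) :
    ∀ᵐ ω ∂P, Tendsto (fun n : ℕ => (n:ℝ)⁻¹ * ∑ k ∈ Finset.Icc 1 n, f k (T^[k] ω)) atTop
      (𝓝 (∫ ω, g ω ∂P)) := by
  have hfD' := ae_all_iff.2 hfD
  have hgD : ∀ᵐ ω ∂P, |g ω| ≤ D ω := by
    filter_upwards [hlim, hfD'] with ω h1 h2
    exact le_of_tendsto' h1.abs h2
  have hgi : Integrable g P := hD.mono' hgm.aestronglyMeasurable hgD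
  let F : ℕ → Ω → ℝ := fun N ω => ⨆ k : ℕ, |f (N + k) ω - g ω|
  have hbd : ∀ᵐ ω ∂P, ∀ k, |f k ω - g ω| ≤ 2 * D ω := by
    filter_upwards [hgD, hfD'] with ω h1 h2 k
    have := abs_sub (f k ω) (g ω)
    linarith [h2 k]
  have hFm : ∀ N, Measurable (F N) := fun N => Measurable.iSup fun k => ((hfm _).sub hgm).abs
  have hFnn : ∀ N ω, 0 ≤ F N ω := fun N ω => Real.iSup_nonneg fun k => abs_nonneg _
  have hFD : ∀ᵐ ω ∂P, ∀ N, F N ω ≤ 2 * D ω := by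
    filter_upwards [hbd] with ω h N
    exact ciSup_le fun k => h _
  have hFle : ∀ᵐ ω ∂P, ∀ N k, N ≤ k → |f k ω - g ω| ≤ F N ω := by
    filter_upwards [hbd] with ω h N k hk
    have := le_ciSup (f := fun k : ℕ => |f (N + k) ω - g ω|)
      ⟨2 * D ω, by rintro _ ⟨k, rfl⟩; exact h _⟩ (k - N)
    simpa [Nat.add_sub_cancel' hk] using this
  have hF0 : ∀ᵐ ω ∂P, Tendsto (fun N => F N ω) atTop (𝓝 0) := by
    filter_upwards [hlim] with ω h1
    rw [Metric.tendsto_atTop] at h1 ⊢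
    intro ε hε
    obtain ⟨N, hN⟩ := h1 (ε/2) (half_pos hε)
    refine ⟨N, fun n hn => ?_⟩
    rw [Real.dist_eq, sub_zero, abs_of_nonneg (hFnn _ _)]
    refine lt_of_le_of_lt (ciSup_le fun k => ?_) (half_lt_self hε)
    have := hN (n + k) (by omega)
    rw [Real.dist_eq] at this
    exact this.le
  have hFi : ∀ N, Integrable (F N) P := fun N => (hD.const_mul 2).mono' (hFm N).aestronglyMeasurable (by
    filter_upwards [hFD] with ω h
    rw [Real.norm_eq_abs, abs_of_nonneg (hFnn _ _)]; exact h N)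
  have hint : Tendsto (fun N => ∫ ω, F N ω ∂P) atTop (𝓝 0) := by
    have := tendsto_integral_of_dominated_convergence (μ := P) (F := F) (f := fun _ => 0)
      (fun ω => 2 * D ω) (fun N => (hFm N).aestronglyMeasurable) (hD.const_mul 2) (fun N => by
        filter_upwards [hFD] with ω h
        rw [Real.norm_eq_abs, abs_of_nonneg (hFnn _ _)]; exact h N) hF0
    simpa using this
  have hB := ae_all_iff.2 fun N => birk hT (hFi N)
  filter_upwards [hB, birk hT hgi, ae_iterate hT.toMeasurePreserving (fun _ => hFle)] with ω h1 h2 h3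
  have key : Tendsto (fun n : ℕ => (n:ℝ)⁻¹ * ∑ k ∈ Finset.Icc 1 n, |f k (T^[k] ω) - g (T^[k] ω)|)
      atTop (𝓝 0) := by
    rw [Metric.tendsto_nhds]
    intro ε hε
    obtain ⟨N, hN⟩ := (hint.eventually_lt_const (half_pos hε)).exists
    let B := ∑ k ∈ Finset.range N, |f k (T^[k] ω) - g (T^[k] ω)|
    have hlim : Tendsto (fun n : ℕ => B * (n:ℝ)⁻¹) atTop (𝓝 (B * 0)) :=
      (tendsto_natCast_atTop_atTop.inv_tendsto_atTop.const_mul B)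
    filter_upwards [(h1 N).eventually_lt_const hN, hlim.eventually_lt_const (by linarith : B * 0 < ε/2)] with n a b
    rw [Real.dist_eq, sub_zero, abs_of_nonneg (by positivity)]
    have : ∑ k ∈ Finset.Icc 1 n, |f k (T^[k] ω) - g (T^[k] ω)| ≤ B + ∑ k ∈ Finset.Icc 1 n, F N (T^[k] ω) := by
      have hsplit : ∀ k, |f k (T^[k] ω) - g (T^[k] ω)| ≤
          (if k < N then |f k (T^[k] ω) - g (T^[k] ω)| else 0) + F N (T^[k] ω) := by
        intro k
        split_ifs with hk
        · linarith [hFnn N (T^[k] ω)]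
        · linarith [h3 k N k (by omega)]
      refine (Finset.sum_le_sum fun k _ => hsplit k).trans ?_
      rw [Finset.sum_add_distrib]
      gcongr
      rw [← Finset.sum_filter]
      refine Finset.sum_le_sum_of_subset_of_nonneg ?_ (fun _ _ _ => abs_nonneg _)
      intro k hk
      simp at hk ⊢
      exact hk.2
    have h5 : (n:ℝ)⁻¹ * ∑ k ∈ Finset.Icc 1 n, |f k (T^[k] ω) - g (T^[k] ω)| ≤
       (n:ℝ)⁻¹ * (B + ∑ k ∈ Finset.Icc 1 n, F N (T^[k] ω)) := by gcongr
    rw [mul_add] at h5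
    linarith
  have key2 : Tendsto (fun n : ℕ => (n:ℝ)⁻¹ * ∑ k ∈ Finset.Icc 1 n, (f k (T^[k] ω) - g (T^[k] ω)))
      atTop (𝓝 0) := by
    refine squeeze_zero_norm (fun n => ?_) key
    rw [norm_mul, Real.norm_eq_abs, Real.norm_eq_abs, abs_of_nonneg (by positivity : (0:ℝ) ≤ (n:ℝ)⁻¹)]
    gcongr
    exact Finset.abs_sum_le_sum_abs _ _
  have := key2.add h2
  rw [zero_add] at this
  refine this.congr fun n => ?_
  rw [Finset.sum_sub_distrib]
  ring


theorem slln_orth {Ω : Type*} [m0 : MeasurableSpace Ω] {P : Measure Ω} [IsProbabilityMeasure P]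
    {X : ℕ → Ω → ℝ} (hXm : ∀ k, AEStronglyMeasurable (X k) P) {C : ℝ}
    (hC : ∀ k, ∀ᵐ ω ∂P, |X k ω| ≤ C)
    (horth : ∀ k l, l < k → ∫ ω, X k ω * X l ω ∂P = 0) :
    ∀ᵐ ω ∂P, Tendsto (fun n : ℕ => (n:ℝ)⁻¹ * ∑ k ∈ Finset.Icc 1 n, X k ω) atTop (𝓝 0) := by
  have hC0 : 0 ≤ C := by
    obtain ⟨ω, h⟩ := (hC 0).exists
    exact (abs_nonneg _).trans h
  have hprod : ∀ k l, Integrable (fun ω => X k ω * X l ω) P := by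
    intro k l
    refine Integrable.of_bound ((hXm k).mul (hXm l)) (C * C) ?_
    filter_upwards [hC k, hC l] with ω h1 h2
    rw [Real.norm_eq_abs, abs_mul]
    exact mul_le_mul h1 h2 (abs_nonneg _) hC0
  have hsq : ∀ k, ∫ ω, X k ω * X k ω ∂P ≤ C * C := by
    intro k
    have : ∫ ω, X k ω * X k ω ∂P ≤ ∫ ω, C * C ∂P := by
      refine integral_mono_ae (hprod k k) (integrable_const _) ?_
      filter_upwards [hC k] with ω h1
      rw [← abs_mul_abs_self]
      exact mul_le_mul h1 h1 (abs_nonneg _) hC0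
    simpa using this
  let S : ℕ → Ω → ℝ := fun n ω => ∑ k ∈ Finset.Icc 1 n, X k ω
  have hSS : ∀ n ω, S n ω ^ 2 = ∑ k ∈ Finset.Icc 1 n, ∑ l ∈ Finset.Icc 1 n, X k ω * X l ω := by
    intro n ω
    simp only [S]
    rw [sq, Finset.sum_mul_sum]
  have hSi : ∀ n, Integrable (fun ω => S n ω ^ 2) P := by
    intro n
    simp only [hSS]
    exact integrable_finsetSum _ fun k _ => integrable_finsetSum _ fun l _ => hprod k l
  have hSint : ∀ n, ∫ ω, S n ω ^ 2 ∂P ≤ n * (C * C) := by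
    intro n
    simp only [hSS]
    rw [integral_finsetSum _ fun k _ => integrable_finsetSum _ fun l _ => hprod k l]
    have : ∀ k ∈ Finset.Icc 1 n, ∫ ω, ∑ l ∈ Finset.Icc 1 n, X k ω * X l ω ∂P ≤ C * C := by
      intro k hk
      rw [integral_finsetSum _ fun l _ => hprod k l]
      rw [Finset.sum_eq_single_of_mem k hk]
      · exact hsq k
      · intro l _ hlk
        rcases lt_or_gt_of_ne hlk with h | h
        · exact horth k l h
        · rw [← horth l k h]
          simp only [mul_comm]
    refine (Finset.sum_le_sum this).trans ?_
    simp
  let Q : ℕ → Ω → ℝ := fun N ω => (((N:ℝ)^2)⁻¹ * S (N^2) ω) ^ 2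
  have hQi : ∀ N, Integrable (Q N) P := by
    intro N
    simp only [Q, mul_pow]
    exact (hSi _).const_mul _
  have hQint : ∀ N, ∫ ω, Q N ω ∂P ≤ C * C * (1 / (N:ℝ)^2) := by
    intro N
    simp only [Q, mul_pow]
    rw [integral_const_mul]
    have h1 := hSint (N^2)
    push_cast at h1
    rcases Nat.eq_zero_or_pos N with rfl | hN
    · simp
    have hN' : (0:ℝ) < N := by exact_mod_cast hN
    calc (((N:ℝ)^2)⁻¹)^2 * ∫ ω, S (N^2) ω ^ 2 ∂P ≤ (((N:ℝ)^2)⁻¹)^2 * ((N:ℝ)^2 * (C * C)) := by gcongr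
      _ = C * C * (1 / (N:ℝ)^2) := by field_simp
  have hsum : Summable fun N : ℕ => C * C * (1 / (N:ℝ)^2) :=
    (Real.summable_one_div_nat_pow.2 (by norm_num)).mul_left _
  have hfin : ∫⁻ ω, ∑' N, ENNReal.ofReal (Q N ω) ∂P ≠ ∞ := by
    rw [lintegral_tsum fun N => (hQi N).1.aemeasurable.ennreal_ofReal]
    have : ∀ N, ∫⁻ ω, ENNReal.ofReal (Q N ω) ∂P ≤ ENNReal.ofReal (C * C * (1 / (N:ℝ)^2)) := by
      intro N
      rw [← ofReal_integral_eq_lintegral_ofReal (hQi N) (ae_of_all _ fun ω => sq_nonneg _)]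
      exact ENNReal.ofReal_le_ofReal (hQint N)
    refine ne_top_of_le_ne_top ?_ (ENNReal.tsum_le_tsum this)
    exact hsum.tsum_ofReal_ne_top
  have hae := ae_lt_top' (AEMeasurable.tsum fun N => (hQi N).1.aemeasurable.ennreal_ofReal) hfin
  filter_upwards [hae, ae_all_iff.2 hC] with ω h1 h2
  have h3 : Tendsto (fun N : ℕ => Q N ω) atTop (𝓝 0) := by
    have := ENNReal.tendsto_atTop_zero_of_tsum_ne_top h1.ne
    have h4 := (ENNReal.tendsto_toReal ENNReal.zero_ne_top).comp this
    simpa [Function.comp_def, ENNReal.toReal_ofReal (sq_nonneg _), Q] using h4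
  have h4 : Tendsto (fun N : ℕ => |((N:ℝ)^2)⁻¹ * S (N^2) ω|) atTop (𝓝 0) := by
    have := h3.sqrt
    simpa [Q, Real.sqrt_sq_eq_abs] using this
  have h5 : Tendsto (fun N : ℕ => |((N:ℝ)^2)⁻¹ * S (N^2) ω| + 2 * C * (N:ℝ)⁻¹) atTop (𝓝 (0 + 2 * C * 0)) :=
    h4.add (tendsto_natCast_atTop_atTop.inv_tendsto_atTop.const_mul (2 * C))
  rw [mul_zero, add_zero] at h5
  have hsqrt : Tendsto Nat.sqrt atTop atTop := by
    refine tendsto_atTop.2 fun b => ?_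
    filter_upwards [eventually_ge_atTop (b * b)] with n hn
    exact Nat.le_sqrt.2 hn
  refine squeeze_zero_norm' ?_ (h5.comp hsqrt)
  filter_upwards [eventually_ge_atTop 1] with n hn
  simp only [Function.comp]
  set N := Nat.sqrt n with hN
  have hN1 : 1 ≤ N := Nat.le_sqrt.2 (by simpa using hn)
  have hNn : N ^ 2 ≤ n := by rw [sq]; exact Nat.sqrt_le n
  have hnN : n ≤ N^2 + 2 * N := by have := Nat.sqrt_le_add n; rw [← hN] at this; rw [sq]; omega
  have hN1' : (0:ℝ) < N := by exact_mod_cast hN1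
  have hdiff : |S n ω| ≤ |S (N^2) ω| + 2 * N * C := by
    have hs : S n ω = S (N^2) ω + ∑ k ∈ Finset.Ico (N^2) n, X (k+1) ω := by
      simp only [S]
      rw [sum_Icc_range (fun k => X k ω), sum_Icc_range (fun k => X k ω),
        Finset.sum_range_add_sum_Ico _ hNn]
    rw [hs]
    refine (abs_add_le _ _).trans ?_
    gcongr
    refine (Finset.abs_sum_le_sum_abs _ _).trans ?_
    refine (Finset.sum_le_sum fun k _ => h2 (k+1)).trans ?_
    rw [Finset.sum_const, nsmul_eq_mul, Nat.card_Ico]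
    gcongr
    have : n - N^2 ≤ 2 * N := by omega
    exact_mod_cast this
  rw [Real.norm_eq_abs, abs_mul, abs_mul, abs_inv, abs_inv, abs_of_nonneg (by positivity : (0:ℝ) ≤ (N:ℝ)^2),
    abs_of_nonneg (by positivity : (0:ℝ) ≤ (n:ℝ))]
  have hNn' : (N:ℝ)^2 ≤ n := by exact_mod_cast hNn
  calc (n:ℝ)⁻¹ * |∑ k ∈ Finset.Icc 1 n, X k ω| ≤ ((N:ℝ)^2)⁻¹ * (|S (N^2) ω| + 2 * N * C) := by
        gcongr
    _ = _ := by field_simp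

theorem slln_md {Ω : Type*} {G1 G2 : MeasurableSpace Ω} {m0 : MeasurableSpace Ω} {P : Measure Ω}
    [IsProbabilityMeasure P] {T S : Ω → Ω} (hT : MeasurePreserving T P P)
    (hS : MeasurePreserving S P P) (hST : Function.LeftInverse S T) (h12 : G1 ≤ G2) (h2 : G2 ≤ m0)
    (hSG : Measurable[G1, G2] S) {d : ℕ → Ω → ℝ} (hdm : ∀ k, StronglyMeasurable[G2] (d k)) {C : ℝ}
    (hC : ∀ k, ∀ᵐ ω ∂P, |d k ω| ≤ C) (hd0 : ∀ k, P[d k | G1] =ᵐ[P] 0) :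
    ∀ᵐ ω ∂P, Tendsto (fun n : ℕ => (n:ℝ)⁻¹ * ∑ k ∈ Finset.Icc 1 n, d k (T^[k] ω)) atTop (𝓝 0) := by
  have hdm0 : ∀ k, StronglyMeasurable[m0] (d k) := fun k => (hdm k).mono h2
  have hi : ∀ k, Integrable (d k) P := fun k => Integrable.of_bound (hdm0 k).aestronglyMeasurable C (hC k)
  refine slln_orth (X := fun k ω => d k (T^[k] ω)) (C := C) ?_ ?_ ?_
  · intro k
    exact ((hdm0 k).comp_measurable (hT.iterate k).measurable).aestronglyMeasurable
  · intro k
    exact (hT.iterate k).quasiMeasurePreserving.ae (hC k)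
  · intro k l hlk
    obtain ⟨p, rfl⟩ : ∃ p, k = p + 1 + l := ⟨k - l - 1, by omega⟩
    have hSp : Measurable[G1, G2] (S^[p+1]) := by
      have h22 : Measurable[G2, G2] S := hSG.mono h12 le_rfl
      rw [Function.iterate_succ]
      exact (Measurable.iterate h22 p).comp hSG
    let h : Ω → ℝ := fun ω => d (p+1+l) ω * d l (S^[p+1] ω)
    have hG1m : StronglyMeasurable[G1] (fun ω => d l (S^[p+1] ω)) :=
      (hdm l).comp_measurable hSp
    have hhT : ∀ ω, d (p+1+l) (T^[p+1+l] ω) * d l (T^[l] ω) = h (T^[p+1+l] ω) := by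
      intro ω
      simp only [h]
      rw [Function.iterate_add_apply T (p+1) l, (hST.iterate (p+1))]
    have hbd : ∀ᵐ ω ∂P, |d l (S^[p+1] ω)| ≤ C :=
      (hS.iterate (p+1)).quasiMeasurePreserving.ae (hC l)
    have hhi : Integrable h P := by
      exact Integrable.mul_bdd (c := C) (hi _) (hG1m.mono (h12.trans h2)).aestronglyMeasurable hbd
    have hTk := hT.iterate (p+1+l)
    calc ∫ ω, d (p+1+l) (T^[p+1+l] ω) * d l (T^[l] ω) ∂P = ∫ ω, h (T^[p+1+l] ω) ∂P := by simp only [hhT]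
      _ = ∫ ω, h ω ∂P := by
        rw [← integral_map hTk.measurable.aemeasurable (by rw [hTk.map_eq]; exact hhi.1), hTk.map_eq]
      _ = ∫ ω, (P[h | G1]) ω ∂P := (integral_condExp (h12.trans h2)).symm
      _ = ∫ ω, 0 ∂P := by
        refine integral_congr_ae ?_
        have := condExp_mul_of_stronglyMeasurable_right (μ := P) hG1m hhi (hi _)
        filter_upwards [this, hd0 (p+1+l)] with ω h1 h2
        refine h1.trans ?_; simp [h2]
      _ = 0 := by simp

theorem condExp_diff_le {Ω : Type*} {G : MeasurableSpace Ω} {m0 : MeasurableSpace Ω} {P : Measure Ω}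
    {f c φ : Ω → ℝ} (hf : Integrable f P) (hc : Integrable c P) (hφ : Integrable φ P)
    (h : ∀ᵐ ω ∂P, |f ω - c ω| ≤ φ ω) :
    ∀ᵐ ω ∂P, |(P[f | G]) ω - (P[c | G]) ω| ≤ (P[φ | G]) ω := by
  have h1 : P[f - c | G] ≤ᵐ[P] P[φ | G] := condExp_mono (hf.sub hc) hφ (by
    filter_upwards [h] with ω hω using (le_abs_self _).trans hω)
  have h2 : P[c - f | G] ≤ᵐ[P] P[φ | G] := condExp_mono (hc.sub hf) hφ (by
    filter_upwards [h] with ω hω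
    have := (neg_abs_le (f ω - c ω))
    simp only [Pi.sub_apply]; linarith)
  filter_upwards [h1, h2, condExp_sub hf hc G, condExp_sub hc hf G] with ω a b e1 e2
  rw [e1] at a
  rw [e2] at b
  simp only [Pi.sub_apply] at a b
  rw [abs_le]
  constructor <;> linarith

theorem condExp_abs_le {Ω : Type*} {G : MeasurableSpace Ω} {m0 : MeasurableSpace Ω} {P : Measure Ω}
    {f φ : Ω → ℝ} (hf : Integrable f P) (hφ : Integrable φ P)
    (h : ∀ᵐ ω ∂P, |f ω| ≤ φ ω) :
    ∀ᵐ ω ∂P, |(P[f | G]) ω| ≤ (P[φ | G]) ω := by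
  have := condExp_diff_le (G := G) hf (integrable_zero Ω ℝ P) hφ (by simpa using h)
  simpa [condExp_zero] using this

theorem core {Ω : Type*} {G : ℤ → MeasurableSpace Ω} {F0 : MeasurableSpace Ω}
    {m0 : MeasurableSpace Ω} {P : Measure Ω} [IsProbabilityMeasure P] {T S : Ω → Ω}
    (hT : Ergodic T P) (hS : MeasurePreserving S P P) (hST : Function.LeftInverse S T)
    (hGmono : ∀ j, G j ≤ G (j+1)) (hGm : ∀ j, G j ≤ m0) (hSG : ∀ j, Measurable[G j, G (j+1)] S)
    {f : ℕ → Ω → ℝ} (hfm : ∀ k, Measurable (f k)) {Λ : Ω → ℝ} (hΛ : Integrable Λ P)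
    (hfΛ : ∀ k, ∀ᵐ ω ∂P, |f k ω| ≤ Λ ω) {g₁ g₂ : ℕ → Ω → ℝ} (hg₁ : ∀ n, Integrable (g₁ n) P)
    (hg₂ : ∀ n, Integrable (g₂ n) P)
    (hg₁0 : Tendsto (fun n : ℕ => ∫ ω, |g₁ n ω| ∂P) atTop (𝓝 0))
    (hg₂0 : Tendsto (fun n : ℕ => ∫ ω, |g₂ n ω| ∂P) atTop (𝓝 0))
    (h1 : ∀ (n : ℕ) k, ∀ᵐ ω ∂P, |(P[f k | G n]) ω - f k ω| ≤ g₁ n ω)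
    (h2 : ∀ (n : ℕ) k, ∀ᵐ ω ∂P, |(P[f k | G (-(n:ℤ))]) ω - (P[f k | F0]) ω| ≤ g₂ n ω) :
    ∀ᵐ ω ∂P, Tendsto (fun n : ℕ => (n:ℝ)⁻¹ * ∑ k ∈ Finset.Icc 1 n,
      (f k (T^[k] ω) - (P[f k | F0]) (T^[k] ω))) atTop (𝓝 0) := by
  have hTp := hT.toMeasurePreserving
  have hfi : ∀ k, Integrable (f k) P := fun k => hΛ.mono' (hfm k).aestronglyMeasurable (hfΛ k)
  suffices H : ∀ ε : ℝ, 0 < ε → ∀ᵐ ω ∂P, ∀ᶠ n : ℕ in atTop, |(n:ℝ)⁻¹ * ∑ k ∈ Finset.Icc 1 n,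
      (f k (T^[k] ω) - (P[f k | F0]) (T^[k] ω))| ≤ ε by
    have H' := ae_all_iff.2 fun j : ℕ => H (1 / ((j:ℝ)+1)) (by positivity)
    filter_upwards [H'] with ω hω
    rw [Metric.tendsto_nhds]
    intro ε hε
    obtain ⟨j, hj⟩ := exists_nat_one_div_lt hε
    filter_upwards [hω j] with n hn
    rw [Real.dist_eq, sub_zero]
    exact hn.trans_lt hj
  intro ε hε
  have hφi : ∀ M : ℕ, Integrable (fun ω => max 0 (Λ ω - M)) P := fun M =>
    (integrable_const (0:ℝ)).sup (hΛ.sub (integrable_const (M:ℝ)))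
  have hφ0 : Tendsto (fun M : ℕ => ∫ ω, max 0 (Λ ω - M) ∂P) atTop (𝓝 0) := by
    have := tendsto_integral_of_dominated_convergence (μ := P) (F := fun (M : ℕ) ω => max 0 (Λ ω - M))
      (f := fun _ => 0) (fun ω => |Λ ω|) (fun M => (hφi M).1) hΛ.abs (fun M => by
        refine ae_of_all _ fun ω => ?_
        rw [Real.norm_eq_abs, abs_of_nonneg (le_max_left _ _)]
        refine max_le (abs_nonneg _) ?_
        have : (0:ℝ) ≤ M := by positivity
        linarith [le_abs_self (Λ ω)]) (by
        refine ae_of_all _ fun ω => ?_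
        refine tendsto_const_nhds.congr' ?_
        filter_upwards [tendsto_natCast_atTop_atTop.eventually_ge_atTop (Λ ω)] with M hM
        rw [max_eq_left (by linarith)])
    simpa using this
  obtain ⟨n, hn⟩ := (hg₁0.eventually_lt_const (by positivity : 0 < ε/5)).exists
  obtain ⟨m, hm⟩ := (hg₂0.eventually_lt_const (by positivity : 0 < ε/5)).exists
  obtain ⟨M, hM⟩ := (hφ0.eventually_lt_const (by positivity : 0 < ε/5)).exists
  set φ : Ω → ℝ := fun ω => max 0 (Λ ω - M) with hφ
  let c : ℕ → Ω → ℝ := fun k ω => max (-(M:ℝ)) (min M (f k ω))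
  have hcm : ∀ k, Measurable (c k) := fun k => measurable_const.max (measurable_const.min (hfm k))
  have hM0 : (0:ℝ) ≤ M := by positivity
  have hcM : ∀ k ω, |c k ω| ≤ M := by
    intro k ω
    rw [abs_le]
    exact ⟨le_max_left _ _, max_le (by linarith) (min_le_left _ _)⟩
  have hci : ∀ k, Integrable (c k) P := fun k =>
    Integrable.of_bound (hcm k).aestronglyMeasurable M (ae_of_all _ (hcM k))
  have hfc : ∀ k, ∀ᵐ ω ∂P, |f k ω - c k ω| ≤ φ ω := by
    intro k
    filter_upwards [hfΛ k] with ω h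
    have ⟨h3, h4⟩ := abs_le.1 h
    simp only [c, hφ]
    have a1 := le_max_left 0 (Λ ω - M)
    have a2 := le_max_right 0 (Λ ω - M)
    rcases max_cases (-(M:ℝ)) (min M (f k ω)) with ⟨b1, b2⟩ | ⟨b1, b2⟩ <;>
    rcases min_cases (M:ℝ) (f k ω) with ⟨b3, b4⟩ | ⟨b3, b4⟩ <;>
    rw [b1] <;> try rw [b3]
    all_goals
      rw [abs_le]
      rw [b3] at b2
      constructor <;> linarith
  let a : ℕ → ℕ → Ω → ℝ := fun k i => P[c k | G (-(m:ℤ) + i)]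
  let d : ℕ → ℕ → Ω → ℝ := fun i k => P[c k | G (-(m:ℤ) + i + 1)] - P[c k | G (-(m:ℤ) + i)]
  have hslln : ∀ i, ∀ᵐ ω ∂P, Tendsto (fun N : ℕ => (N:ℝ)⁻¹ * ∑ k ∈ Finset.Icc 1 N, d i k (T^[k] ω))
      atTop (𝓝 0) := by
    intro i
    refine slln_md (G1 := G (-(m:ℤ) + i)) (G2 := G (-(m:ℤ) + i + 1)) (C := 2 * M) hTp hS hST
      (hGmono _) (hGm _) (hSG _) ?_ ?_ ?_
    · intro k
      exact stronglyMeasurable_condExp.sub (stronglyMeasurable_condExp.mono (hGmono _))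
    · intro k
      have e1 := ae_bdd_abs_condExp_of_ae_bdd_abs (μ := P) (m := G (-(m:ℤ) + i + 1)) (ae_of_all _ (hcM k))
      have e2 := ae_bdd_abs_condExp_of_ae_bdd_abs (μ := P) (m := G (-(m:ℤ) + i)) (ae_of_all _ (hcM k))
      filter_upwards [e1, e2] with ω e1 e2
      simp only [d, Pi.sub_apply]
      refine (abs_sub _ _).trans ?_
      linarith
    · intro k
      have e1 := condExp_sub (m := G (-(m:ℤ) + i)) (μ := P) (f := P[c k | G (-(m:ℤ) + i + 1)])
        (g := P[c k | G (-(m:ℤ) + i)]) integrable_condExp integrable_condExp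
      have e2 := condExp_condExp_of_le (μ := P) (f := c k) (hGmono (-(m:ℤ) + i)) (hGm _)
      have e3 := condExp_condExp_of_le (μ := P) (f := c k) (le_refl (G (-(m:ℤ) + i))) (hGm _)
      filter_upwards [e1, e2, e3] with ω e1 e2 e3
      refine e1.trans ?_
      simp only [Pi.sub_apply, Pi.zero_apply]
      rw [e2, e3, sub_self]
  have hd : ∀ k ω, ∑ i ∈ Finset.range (m + n), d i k ω = (P[c k | G n]) ω - (P[c k | G (-(m:ℤ))]) ω := by
    intro k ω
    have e1 : ∀ i, d i k ω = a k (i+1) ω - a k i ω := by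
      intro i
      simp only [d, a, Pi.sub_apply, Nat.cast_add, Nat.cast_one, add_assoc]
    simp only [e1]
    rw [Finset.sum_range_sub (fun i => a k i ω)]
    simp only [a, Nat.cast_add, Nat.cast_zero, add_zero, neg_add_cancel_left]
  let W : Ω → ℝ := fun ω => |g₁ n ω| + |g₂ m ω| + (P[φ | G n]) ω + (P[φ | G (-(m:ℤ))]) ω
  have hWi : Integrable W P :=
    ((((hg₁ n).abs).add (hg₂ m).abs).add integrable_condExp).add integrable_condExp
  have hWint : ∫ ω, W ω ∂P < 4 * ε / 5 := by
    have : ∫ ω, W ω ∂P = ∫ ω, |g₁ n ω| ∂P + ∫ ω, |g₂ m ω| ∂P + ∫ ω, φ ω ∂P + ∫ ω, φ ω ∂P := by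
      simp only [W]
      have i1 : Integrable (fun ω => |g₁ n ω| + |g₂ m ω|) P := (hg₁ n).abs.add (hg₂ m).abs
      have i2 : Integrable (fun ω => |g₁ n ω| + |g₂ m ω| + (P[φ | G n]) ω) P :=
        i1.add integrable_condExp
      rw [integral_add i2 integrable_condExp,
        integral_add i1 integrable_condExp,
        integral_add (hg₁ n).abs (hg₂ m).abs, integral_condExp (hGm _), integral_condExp (hGm _)]
    rw [this]; linarith
  have hW : ∀ k, ∀ᵐ ω ∂P, |f k ω - (P[f k | F0]) ω - ∑ i ∈ Finset.range (m + n), d i k ω| ≤ W ω := by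
    intro k
    filter_upwards [h1 n k, h2 m k, condExp_diff_le (G := G n) (hfi k) (hci k) (hφi M) (hfc k),
      condExp_diff_le (G := G (-(m:ℤ))) (hfi k) (hci k) (hφi M) (hfc k)] with ω e1 e2 e3 e4
    rw [hd]
    simp only [W]
    have := le_abs_self (g₁ n ω)
    have := le_abs_self (g₂ m ω)
    rw [abs_le] at e1 e2 e3 e4 ⊢
    constructor <;> linarith [e1.1, e1.2, e2.1, e2.2, e3.1, e3.2, e4.1, e4.2]
  filter_upwards [ae_iterate hTp hW, birk hT hWi, ae_all_iff.2 hslln] with ω e1 e2 e3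
  have e4 : Tendsto (fun N : ℕ => ∑ i ∈ Finset.range (m + n),
      |(N:ℝ)⁻¹ * ∑ k ∈ Finset.Icc 1 N, d i k (T^[k] ω)|) atTop (𝓝 0) := by
    have := tendsto_finsetSum (Finset.range (m+n)) (fun i _ => (e3 i).abs)
    simpa using this
  filter_upwards [e2.eventually_lt_const hWint, e4.eventually_lt_const (by positivity : 0 < ε/5)] with N b1 b2
  have hNn : (0:ℝ) ≤ (N:ℝ)⁻¹ := by positivity
  have b3 : (N:ℝ)⁻¹ * ∑ k ∈ Finset.Icc 1 N, (f k (T^[k] ω) - (P[f k | F0]) (T^[k] ω)) =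
      (N:ℝ)⁻¹ * ∑ k ∈ Finset.Icc 1 N, (f k (T^[k] ω) - (P[f k | F0]) (T^[k] ω)
        - ∑ i ∈ Finset.range (m + n), d i k (T^[k] ω)) +
      ∑ i ∈ Finset.range (m + n), (N:ℝ)⁻¹ * ∑ k ∈ Finset.Icc 1 N, d i k (T^[k] ω) := by
    rw [← Finset.mul_sum, Finset.sum_comm, ← mul_add, ← Finset.sum_add_distrib]
    simp
  rw [b3]
  refine (abs_add_le _ _).trans ?_
  have b4 : |(N:ℝ)⁻¹ * ∑ k ∈ Finset.Icc 1 N, (f k (T^[k] ω) - (P[f k | F0]) (T^[k] ω)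
        - ∑ i ∈ Finset.range (m + n), d i k (T^[k] ω))| ≤ (N:ℝ)⁻¹ * ∑ k ∈ Finset.Icc 1 N, W (T^[k] ω) := by
    rw [abs_mul, abs_of_nonneg hNn]
    gcongr
    refine (Finset.abs_sum_le_sum_abs _ _).trans ?_
    exact Finset.sum_le_sum fun k _ => e1 k
  have b5 := Finset.abs_sum_le_sum_abs
    (fun i => (N:ℝ)⁻¹ * ∑ k ∈ Finset.Icc 1 N, d i k (T^[k] ω)) (Finset.range (m + n))
  linarith

theorem condExp_comp {Ω : Type*} {G : MeasurableSpace Ω} {m0 : MeasurableSpace Ω} {P : Measure Ω}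
    [IsProbabilityMeasure P] {T : Ω → Ω} (hT : MeasurePreserving T P P) (hG : G ≤ m0)
    {f : Ω → ℝ} (hf : Integrable f P) :
    P[fun ω => f (T ω) | MeasurableSpace.comap T G] =ᵐ[P] fun ω => (P[f | G]) (T ω) := by
  have hle : MeasurableSpace.comap T G ≤ m0 :=
    (MeasurableSpace.comap_mono hG).trans hT.measurable.comap_le
  have hfT : Integrable (fun ω => f (T ω)) P := hT.integrable_comp_of_integrable hf
  have hcT : Integrable (fun ω => (P[f | G]) (T ω)) P :=
    hT.integrable_comp_of_integrable integrable_condExp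
  symm
  refine ae_eq_condExp_of_forall_setIntegral_eq hle hfT (fun s _ _ => hcT.integrableOn) ?_ ?_
  · rintro s ⟨t, ht, rfl⟩ _
    have e : ∀ g : Ω → ℝ, Integrable g P → ∫ x in T ⁻¹' t, g (T x) ∂P = ∫ x in t, g x ∂P := by
      intro g hg
      have := setIntegral_map (μ := P) (hG t ht) (g := T) (f := g) (by rw [hT.map_eq]; exact hg.1)
        hT.measurable.aemeasurable
      rw [hT.map_eq] at this
      exact this.symm
    rw [e _ integrable_condExp, e _ hf, setIntegral_condExp hG hf ht]
  · have : StronglyMeasurable[MeasurableSpace.comap T G] (fun ω => (P[f | G]) (T ω)) :=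
      StronglyMeasurable.comp_measurable (stronglyMeasurable_condExp (m := G))
        (comap_measurable (m := G) T)
    exact this.aestronglyMeasurable


section helpers

theorem iter_eq_perm {Ω : Type*} {T S : Ω → Ω} (hST : Function.LeftInverse S T)
    (hTS : Function.RightInverse S T) (n : ℤ) :
    iter T S n = ⇑((⟨T, S, hST, hTS⟩ : Equiv.Perm Ω) ^ n) := by
  set e : Equiv.Perm Ω := ⟨T, S, hST, hTS⟩ with he
  cases n with
  | ofNat n =>
    simp only [iter, Int.ofNat_eq_natCast, zpow_natCast, Equiv.Perm.iterate_eq_pow]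
    rw [← Equiv.Perm.iterate_eq_pow]
    rfl
  | negSucc n =>
    simp only [iter, zpow_negSucc]
    rw [← inv_pow, ← Equiv.Perm.iterate_eq_pow]
    rfl

theorem iter_add {Ω : Type*} {T S : Ω → Ω} (hST : Function.LeftInverse S T)
    (hTS : Function.RightInverse S T) (a b : ℤ) :
    iter T S a ∘ iter T S b = iter T S (a + b) := by
  rw [iter_eq_perm hST hTS, iter_eq_perm hST hTS, iter_eq_perm hST hTS, zpow_add]
  rfl

theorem iter_nat {Ω : Type*} (T S : Ω → Ω) (n : ℕ) : iter T S (n : ℤ) = T^[n] := rfl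

theorem iter_neg_nat {Ω : Type*} (T S : Ω → Ω) (n : ℕ) : iter T S (-(n : ℤ)) = S^[n] := by
  cases n with
  | zero => rfl
  | succ n => rfl

theorem iter_measurable {Ω : Type*} [m0 : MeasurableSpace Ω] {T S : Ω → Ω} (hT : Measurable T)
    (hS : Measurable S) (n : ℤ) : Measurable (iter T S n) := by
  cases n with
  | ofNat n => exact hT.iterate n
  | negSucc n => exact hS.iterate (n+1)

theorem obsField_le {Ω : Type*} {Y : MeasurableSpace Ω} [m0 : MeasurableSpace Ω] {T S : Ω → Ω}
    (hT : Measurable T) (hS : Measurable S) (hY : Y ≤ m0) (a b : ℤ) : obsField T S Y a b ≤ m0 :=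
  iSup₂_le fun k _ => (MeasurableSpace.comap_mono hY).trans (iter_measurable hT hS k).comap_le

theorem obsFieldLE_le {Ω : Type*} {Y : MeasurableSpace Ω} [m0 : MeasurableSpace Ω] {T S : Ω → Ω}
    (hT : Measurable T) (hS : Measurable S) (hY : Y ≤ m0) (b : ℤ) : obsFieldLE T S Y b ≤ m0 :=
  iSup₂_le fun k _ => (MeasurableSpace.comap_mono hY).trans (iter_measurable hT hS k).comap_le

theorem obsField_mono {Ω : Type*} {Y : MeasurableSpace Ω} {T S : Ω → Ω}
    {a b a' b' : ℤ} (ha : a' ≤ a) (hb : b ≤ b') : obsField T S Y a b ≤ obsField T S Y a' b' :=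
  iSup₂_le fun k hk => le_iSup₂_of_le k ⟨ha.trans hk.1, hk.2.trans hb⟩ le_rfl

theorem obsField_comap {Ω : Type*} {Y : MeasurableSpace Ω} {T S : Ω → Ω}
    (hST : Function.LeftInverse S T) (hTS : Function.RightInverse S T) (a b p : ℤ) :
    MeasurableSpace.comap (iter T S p) (obsField T S Y a b) = obsField T S Y (a + p) (b + p) := by
  simp only [obsField, MeasurableSpace.comap_iSup, MeasurableSpace.comap_comp, iter_add hST hTS]
  apply le_antisymm
  · exact iSup₂_le fun k hk => le_iSup₂_of_le (k + p) ⟨by have := hk.1; omega, by have := hk.2; omega⟩ le_rfl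
  · exact iSup₂_le fun k hk => le_iSup₂_of_le (k - p) ⟨by have := hk.1; omega, by have := hk.2; omega⟩
      (by rw [sub_add_cancel])

theorem obsFieldLE_comap_le {Ω : Type*} {Y : MeasurableSpace Ω} {T S : Ω → Ω}
    (hST : Function.LeftInverse S T) (hTS : Function.RightInverse S T) :
    MeasurableSpace.comap S (obsFieldLE T S Y 0) ≤ obsFieldLE T S Y 0 := by
  have hS : S = iter T S (-1) := rfl
  conv_lhs => rw [hS]
  simp only [obsFieldLE, MeasurableSpace.comap_iSup, MeasurableSpace.comap_comp]
  rw [← hS]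
  exact iSup₂_le fun k hk => le_iSup₂_of_le (k + -1) (by simp at hk ⊢; omega)
    (by rw [← iter_add hST hTS]; exact le_rfl)

/-- the interpolating filtration -/
def GG {Ω : Type*} (T S : Ω → Ω) (Y X : MeasurableSpace Ω) (j : ℤ) : MeasurableSpace Ω :=
  obsFieldLE T S Y 0 ⊔ MeasurableSpace.comap (iter T S j) X

theorem GG_mono {Ω : Type*} {Y X : MeasurableSpace Ω} {T S : Ω → Ω}
    (hST : Function.LeftInverse S T) (hTS : Function.RightInverse S T)
    (hX1 : X ≤ MeasurableSpace.comap T X) (j : ℤ) : GG T S Y X j ≤ GG T S Y X (j+1) := by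
  refine sup_le_sup le_rfl ?_
  have h := MeasurableSpace.comap_mono (g := iter T S j) hX1
  rw [MeasurableSpace.comap_comp] at h
  have e : T ∘ iter T S j = iter T S (j + 1) := by
    rw [add_comm, ← iter_add hST hTS]; rfl
  rwa [e] at h

theorem GG_le {Ω : Type*} {Y X : MeasurableSpace Ω} [m0 : MeasurableSpace Ω] {T S : Ω → Ω}
    (hT : Measurable T) (hS : Measurable S) (hY : Y ≤ m0) (hX : X ≤ m0) (j : ℤ) :
    GG T S Y X j ≤ m0 :=
  sup_le (obsFieldLE_le hT hS hY 0)
    ((MeasurableSpace.comap_mono hX).trans (iter_measurable hT hS j).comap_le)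

theorem GG_S {Ω : Type*} {Y X : MeasurableSpace Ω} {T S : Ω → Ω}
    (hST : Function.LeftInverse S T) (hTS : Function.RightInverse S T) (j : ℤ) :
    Measurable[GG T S Y X j, GG T S Y X (j+1)] S := by
  rw [measurable_iff_comap_le, GG, MeasurableSpace.comap_sup]
  refine sup_le_sup (obsFieldLE_comap_le hST hTS) ?_
  rw [MeasurableSpace.comap_comp]
  have e : iter T S (j+1) ∘ S = iter T S j := by
    change iter T S (j+1) ∘ iter T S (-1) = _
    rw [iter_add hST hTS, add_neg_cancel_right]
  rw [e]

theorem Umn_sub_Un {Ω U : Type*} [MeasurableSpace U] {Y : MeasurableSpace Ω} {T S : Ω → Ω} (k : ℕ)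
    {v : Ω → U} (hv : v ∈ (Umn T S Y (-(k:ℤ)) 0 : Set (Ω → U))) : v ∈ (Un T S Y 0 : Set (Ω → U)) := by
  simp only [Un, Set.mem_iUnion]
  exact ⟨-(k:ℤ), by simp, hv⟩

theorem Un_exists {Ω U : Type*} [MeasurableSpace U] {Y : MeasurableSpace Ω} {T S : Ω → Ω}
    {v : Ω → U} (hv : v ∈ (Un T S Y 0 : Set (Ω → U))) :
    ∃ j : ℕ, ∀ k : ℕ, j ≤ k → v ∈ (Umn T S Y (-(k:ℤ)) 0 : Set (Ω → U)) := by
  simp only [Un, Set.mem_iUnion] at hv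
  obtain ⟨m, hm, hv⟩ := hv
  have hm0 : m ≤ 0 := hm
  refine ⟨(-m).toNat, fun k hk => ?_⟩
  have hv' : Measurable[obsField T S Y m 0] v := hv
  exact hv'.mono (obsField_mono (by omega) le_rfl) le_rfl

theorem Un_measurable {Ω U : Type*} [MeasurableSpace U] {Y : MeasurableSpace Ω}
    [m0 : MeasurableSpace Ω] {T S : Ω → Ω} (hT : Measurable T) (hS : Measurable S) (hY : Y ≤ m0)
    {v : Ω → U} (hv : v ∈ (Un T S Y 0 : Set (Ω → U))) : Measurable v := by
  obtain ⟨j, hj⟩ := Un_exists hv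
  have hv' : Measurable[obsField T S Y (-(j:ℤ)) 0] v := hj j le_rfl
  exact hv'.mono (obsField_le hT hS hY _ _) le_rfl

theorem loss0_measurable {Ω U : Type*} [MeasurableSpace U] [m0 : MeasurableSpace Ω] {T S : Ω → Ω}
    {ℓ : U → Ω → ℝ} (hℓ : Measurable fun p : U × Ω => ℓ p.1 p.2)
    {v : Ω → U} (hv : Measurable v) : Measurable (lossAt T S ℓ 0 v) :=
  hℓ.comp (hv.prodMk measurable_id)

/-- shift forward: from time 0 to time k -/
theorem shift_mem {Ω U : Type*} [MeasurableSpace U] {Y : MeasurableSpace Ω} {T S : Ω → Ω}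
    (hST : Function.LeftInverse S T) (hTS : Function.RightInverse S T) (k : ℕ)
    {v : Ω → U} (hv : v ∈ (Umn T S Y (-(k:ℤ)) 0 : Set (Ω → U))) :
    (fun ω => v (T^[k] ω)) ∈ (Umn T S Y 0 k : Set (Ω → U)) := by
  have hv' : Measurable[obsField T S Y (-(k:ℤ)) 0] v := hv
  have h : Measurable[obsField T S Y 0 k, obsField T S Y (-(k:ℤ)) 0] (T^[k]) := by
    rw [measurable_iff_comap_le, ← iter_nat T S, obsField_comap hST hTS]
    simp
  exact hv'.comp h

theorem shift_back {Ω U : Type*} [MeasurableSpace U] {Y : MeasurableSpace Ω} {T S : Ω → Ω}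
    (hST : Function.LeftInverse S T) (hTS : Function.RightInverse S T) (k : ℕ)
    {v : Ω → U} (hv : v ∈ (Umn T S Y 0 k : Set (Ω → U))) :
    (fun ω => v (S^[k] ω)) ∈ (Umn T S Y (-(k:ℤ)) 0 : Set (Ω → U)) := by
  have hv' : Measurable[obsField T S Y 0 k] v := hv
  have h : Measurable[obsField T S Y (-(k:ℤ)) 0, obsField T S Y 0 k] (S^[k]) := by
    rw [measurable_iff_comap_le, ← iter_neg_nat T S, obsField_comap hST hTS]
    simp
  exact hv'.comp h

theorem condExp_shift {Ω U : Type*} [MeasurableSpace U] {Y : MeasurableSpace Ω}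
    [m0 : MeasurableSpace Ω] {P : Measure Ω} [IsProbabilityMeasure P] {T S : Ω → Ω}
    (hT : MeasurePreserving T P P) (hS : Measurable S)
    (hST : Function.LeftInverse S T) (hTS : Function.RightInverse S T) (hY : Y ≤ m0)
    {ℓ : U → Ω → ℝ} (k : ℕ) {v : Ω → U} (hv : Integrable (lossAt T S ℓ 0 v) P) :
    P[lossAt T S ℓ k (fun ω => v (T^[k] ω)) | obsField T S Y 0 k] =ᵐ[P]
      fun ω => (P[lossAt T S ℓ 0 v | obsField T S Y (-(k:ℤ)) 0]) (T^[k] ω) := by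
  have h := condExp_comp (hT.iterate k) (obsField_le hT.measurable hS hY (-(k:ℤ)) 0) hv
  have e : MeasurableSpace.comap (T^[k]) (obsField T S Y (-(k:ℤ)) 0) = obsField T S Y 0 k := by
    rw [← iter_nat T S, obsField_comap hST hTS]; simp
  rw [e] at h
  exact h

theorem essSup_integrable {Ω ι : Type*} [m0 : MeasurableSpace Ω] {P : Measure Ω} {S₀ : Set ι}
    (hne : S₀.Nonempty)
    {f : ι → Ω → ℝ} {g D : Ω → ℝ} (hg : IsEssSupFam P S₀ (fun i ω => |f i ω|) g) (hD : Integrable D P)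
    (hfD : ∀ i ∈ S₀, ∀ᵐ ω ∂P, |f i ω| ≤ D ω) : Integrable g P := by
  obtain ⟨i, hi⟩ := hne
  have hDm := hD.1.ae_eq_mk
  have h1 := hg.2.2 (hD.1.mk D) hD.1.stronglyMeasurable_mk.measurable (fun i hi => by
    filter_upwards [hfD i hi, hDm] with ω a b
    rw [← b]; exact a)
  refine hD.mono' hg.1.aestronglyMeasurable ?_
  filter_upwards [h1, hDm, hg.2.1 i hi] with ω a b c
  rw [Real.norm_eq_abs, abs_of_nonneg ((abs_nonneg _).trans c), b]
  exact a

end helpers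


theorem coreU {Ω U : Type*} {Y X : MeasurableSpace Ω} [m0 : MeasurableSpace Ω] [MeasurableSpace U]
    [Nonempty U] (P : Measure Ω) [IsProbabilityMeasure P]
    (T S : Ω → Ω) (hT : Ergodic T P) (hS : MeasurePreserving S P P)
    (hST : Function.LeftInverse S T) (hTS : Function.RightInverse S T)
    (ℓ : U → Ω → ℝ) (hℓ : Measurable fun p : U × Ω => ℓ p.1 p.2)
    (Λ : Ω → ℝ) (hΛ : Integrable Λ P) (hdom : ∀ u ω, |ℓ u ω| ≤ Λ ω)
    (hY : Y ≤ m0) (hX : X ≤ m0) (hX1 : X ≤ MeasurableSpace.comap T X)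
    (g₁ : ℕ → Ω → ℝ)
    (hg₁ : ∀ n : ℕ, IsEssSupFam P (Un T S Y 0 : Set (Ω → U))
      (fun v ω =>
        |(P[lossAt T S ℓ 0 v | obsFieldLE T S Y 0 ⊔ MeasurableSpace.comap (T^[n]) X]) ω -
          lossAt T S ℓ 0 v ω|) (g₁ n))
    (hg₁0 : Tendsto (fun n : ℕ => ∫ ω, |g₁ n ω| ∂P) atTop (𝓝 0))
    (g₂ : ℕ → Ω → ℝ)
    (hg₂ : ∀ n : ℕ, IsEssSupFam P (Un T S Y 0 : Set (Ω → U))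
      (fun v ω =>
        |(P[lossAt T S ℓ 0 v | obsFieldLE T S Y 0 ⊔ MeasurableSpace.comap (S^[n]) X]) ω -
          (P[lossAt T S ℓ 0 v | tailField T S Y X]) ω|) (g₂ n))
    (hg₂0 : Tendsto (fun n : ℕ => ∫ ω, |g₂ n ω| ∂P) atTop (𝓝 0))
    (h3 : ∀ v ∈ (Un T S Y 0 : Set (Ω → U)),
      P[lossAt T S ℓ 0 v | obsFieldLE T S Y 0] =ᵐ[P]
        P[lossAt T S ℓ 0 v | tailField T S Y X])
    (v : ℕ → Ω → U) (hv : ∀ k, v k ∈ (Un T S Y 0 : Set (Ω → U))) :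
    ∀ᵐ ω ∂P, Tendsto (fun n : ℕ => (n:ℝ)⁻¹ * ∑ k ∈ Finset.Icc 1 n,
      (lossAt T S ℓ 0 (v k) (T^[k] ω) -
        (P[lossAt T S ℓ 0 (v k) | obsFieldLE T S Y 0]) (T^[k] ω))) atTop (𝓝 0) := by
  have hTm := hT.measurable
  have hSm := hS.measurable
  have hm : ∀ w ∈ (Un T S Y 0 : Set (Ω → U)), Measurable (lossAt T S ℓ 0 w) := fun w hw =>
    loss0_measurable hℓ (Un_measurable hTm hSm hY hw)
  have hbd : ∀ w : Ω → U, ∀ᵐ ω ∂P, |lossAt T S ℓ 0 w ω| ≤ Λ ω := fun w =>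
    ae_of_all _ fun ω => hdom _ _
  have hi : ∀ w ∈ (Un T S Y 0 : Set (Ω → U)), Integrable (lossAt T S ℓ 0 w) P := fun w hw =>
    hΛ.mono' (hm w hw).aestronglyMeasurable (hbd w)
  have hne : (Un T S Y 0 : Set (Ω → U)).Nonempty := ⟨v 0, hv 0⟩
  have hg₁i : ∀ n, Integrable (g₁ n) P := by
    intro n
    refine essSup_integrable hne (hg₁ n)
      (D := fun ω => (P[Λ | obsFieldLE T S Y 0 ⊔ MeasurableSpace.comap (T^[n]) X]) ω + Λ ω)
      (integrable_condExp.add hΛ) ?_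
    intro w hw
    filter_upwards [condExp_abs_le (G := obsFieldLE T S Y 0 ⊔ MeasurableSpace.comap (T^[n]) X)
      (hi w hw) hΛ (hbd w), hbd w] with ω a b
    exact (abs_sub _ _).trans (add_le_add a b)
  have hg₂i : ∀ n, Integrable (g₂ n) P := by
    intro n
    refine essSup_integrable hne (hg₂ n)
      (D := fun ω => (P[Λ | obsFieldLE T S Y 0 ⊔ MeasurableSpace.comap (S^[n]) X]) ω +
        (P[Λ | tailField T S Y X]) ω)
      (integrable_condExp.add integrable_condExp) ?_
    intro w hw
    filter_upwards [condExp_abs_le (G := obsFieldLE T S Y 0 ⊔ MeasurableSpace.comap (S^[n]) X)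
      (hi w hw) hΛ (hbd w), condExp_abs_le (G := tailField T S Y X)
      (hi w hw) hΛ (hbd w)] with ω a b
    exact (abs_sub _ _).trans (add_le_add a b)
  refine core (G := GG T S Y X) (F0 := obsFieldLE T S Y 0) hT hS hST (GG_mono hST hTS hX1)
    (GG_le hTm hSm hY hX) (GG_S hST hTS) (f := fun k => lossAt T S ℓ 0 (v k))
    (fun k => hm _ (hv k)) hΛ (fun k => hbd _) hg₁i hg₂i hg₁0 hg₂0 ?_ ?_
  · intro n k
    exact (hg₁ n).2.1 (v k) (hv k)
  · intro n k
    have e : GG T S Y X (-(n:ℤ)) = obsFieldLE T S Y 0 ⊔ MeasurableSpace.comap (S^[n]) X := by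
      rw [GG, iter_neg_nat]
    rw [e]
    filter_upwards [(hg₂ n).2.1 (v k) (hv k), h3 _ (hv k)] with ω a b
    rw [b]; exact a

set_option maxHeartbeats 1000000 in
theorem main_aux {Ω U : Type*} {Y X : MeasurableSpace Ω} [m0 : MeasurableSpace Ω]
    [MeasurableSpace U] [Nonempty U]
    (P : Measure Ω) [IsProbabilityMeasure P]
    (T S : Ω → Ω) (hT : Ergodic T P) (hS : MeasurePreserving S P P)
    (hST : Function.LeftInverse S T) (hTS : Function.RightInverse S T)
    (ℓ : U → Ω → ℝ) (hℓ : Measurable fun p : U × Ω => ℓ p.1 p.2)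
    (Λ : Ω → ℝ) (hΛ : Integrable Λ P) (hdom : ∀ u ω, |ℓ u ω| ≤ Λ ω)
    (hY : Y ≤ m0) (hX : X ≤ m0) (hX1 : X ≤ MeasurableSpace.comap T X)
    (g₁ : ℕ → Ω → ℝ)
    (hg₁ : ∀ n : ℕ, IsEssSupFam P (Un T S Y 0 : Set (Ω → U))
      (fun v ω =>
        |(P[lossAt T S ℓ 0 v | obsFieldLE T S Y 0 ⊔ MeasurableSpace.comap (T^[n]) X]) ω -
          lossAt T S ℓ 0 v ω|) (g₁ n))
    (hg₁0 : Tendsto (fun n : ℕ => ∫ ω, |g₁ n ω| ∂P) atTop (𝓝 0))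
    (g₂ : ℕ → Ω → ℝ)
    (hg₂ : ∀ n : ℕ, IsEssSupFam P (Un T S Y 0 : Set (Ω → U))
      (fun v ω =>
        |(P[lossAt T S ℓ 0 v | obsFieldLE T S Y 0 ⊔ MeasurableSpace.comap (S^[n]) X]) ω -
          (P[lossAt T S ℓ 0 v | tailField T S Y X]) ω|) (g₂ n))
    (hg₂0 : Tendsto (fun n : ℕ => ∫ ω, |g₂ n ω| ∂P) atTop (𝓝 0))
    (g₃ : ℕ → Ω → ℝ)
    (hg₃ : ∀ n : ℕ, IsEssSupFam P (Umn T S Y (-(n : ℤ)) 0 : Set (Ω → U))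
      (fun v ω =>
        |(P[lossAt T S ℓ 0 v | obsField T S Y (-(n : ℤ)) 0]) ω -
          (P[lossAt T S ℓ 0 v | obsFieldLE T S Y 0]) ω|) (g₃ n))
    (hg₃0 : ∀ᵐ ω ∂P, Tendsto (fun n : ℕ => g₃ n ω) atTop (𝓝 0))
    (h3 : ∀ v ∈ (Un T S Y 0 : Set (Ω → U)),
      P[lossAt T S ℓ 0 v | obsFieldLE T S Y 0] =ᵐ[P]
        P[lossAt T S ℓ 0 v | tailField T S Y X])
    (ginf : Ω → ℝ)
    (hginf : IsEssInfFam P (Un T S Y 0 : Set (Ω → U))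
      (fun v => P[lossAt T S ℓ 0 v | obsFieldLE T S Y 0]) ginf)
    (ut : ℕ → Ω → U) (hut : MeanOptimalStrategy P T S Y ℓ ut) :
    (∀ᵐ ω ∂P, Tendsto (fun n : ℕ => avgLoss T S ℓ ut n ω) atTop (𝓝 (∫ ω, ginf ω ∂P))) ∧
      PathwiseOptimal P T S Y ℓ ut := by
  have hTm := hT.measurable
  have hSm := hS.measurable
  have hTp := hT.toMeasurePreserving
  have hm : ∀ w ∈ (Un T S Y 0 : Set (Ω → U)), Measurable (lossAt T S ℓ 0 w) := fun w hw =>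
    loss0_measurable hℓ (Un_measurable hTm hSm hY hw)
  have hbd : ∀ w : Ω → U, ∀ᵐ ω ∂P, |lossAt T S ℓ 0 w ω| ≤ Λ ω := fun w =>
    ae_of_all _ fun ω => hdom _ _
  have hi : ∀ w ∈ (Un T S Y 0 : Set (Ω → U)), Integrable (lossAt T S ℓ 0 w) P := fun w hw =>
    hΛ.mono' (hm w hw).aestronglyMeasurable (hbd w)
  have hF0 : obsFieldLE T S Y 0 ≤ m0 := obsFieldLE_le hTm hSm hY 0
  set Λb : Ω → ℝ := P[Λ | obsFieldLE T S Y 0] with hΛb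
  have hΛbi : Integrable Λb P := integrable_condExp
  have hem : ∀ w : Ω → U, Measurable (P[lossAt T S ℓ 0 w | obsFieldLE T S Y 0]) := fun w =>
    (stronglyMeasurable_condExp.mono hF0).measurable
  have heΛ : ∀ w ∈ (Un T S Y 0 : Set (Ω → U)),
      ∀ᵐ ω ∂P, |(P[lossAt T S ℓ 0 w | obsFieldLE T S Y 0]) ω| ≤ Λb ω := fun w hw =>
    condExp_abs_le (hi w hw) hΛ (hbd w)
  -- time-zero version of a strategy
  let V : (ℕ → Ω → U) → ℕ → Ω → U := fun u k =>
    if 1 ≤ k then (fun ω => u k (S^[k] ω)) else fun _ => Classical.arbitrary U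
  have hV : ∀ u : ℕ → Ω → U, Admissible T S Y u → ∀ k : ℕ, V u k ∈ (Umn T S Y (-(k:ℤ)) 0 : Set (Ω → U)) := by
    intro u hu k
    by_cases hk : 1 ≤ k
    · simp only [V, if_pos hk]
      exact shift_back hST hTS k (hu k hk)
    · simp only [V, if_neg hk]
      exact @measurable_const _ _ _ (_) _
  have hVn : ∀ u : ℕ → Ω → U, Admissible T S Y u → ∀ k, V u k ∈ (Un T S Y 0 : Set (Ω → U)) :=
    fun u hu k => Umn_sub_Un k (hV u hu k)
  have hVT : ∀ (u : ℕ → Ω → U) (k : ℕ), 1 ≤ k → (fun ω => V u k (T^[k] ω)) = u k := by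
    intro u k hk
    funext ω
    simp only [V, if_pos hk]
    rw [hST.iterate k]
  have hVl : ∀ (u : ℕ → Ω → U) (n : ℕ) (ω : Ω), avgLoss T S ℓ u n ω =
      (n:ℝ)⁻¹ * ∑ k ∈ Finset.Icc 1 n, lossAt T S ℓ 0 (V u k) (T^[k] ω) := by
    intro u n ω
    simp only [avgLoss]
    congr 1
    refine Finset.sum_congr rfl fun k hk => ?_
    have := congrFun (hVT u k (Finset.mem_Icc.1 hk).1) ω
    simp only [lossAt]
    rw [this]
    rfl
  have hA : ∀ u : ℕ → Ω → U, Admissible T S Y u → ∀ᵐ ω ∂P, Tendsto (fun n : ℕ =>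
      avgLoss T S ℓ u n ω - (n:ℝ)⁻¹ * ∑ k ∈ Finset.Icc 1 n,
        (P[lossAt T S ℓ 0 (V u k) | obsFieldLE T S Y 0]) (T^[k] ω)) atTop (𝓝 0) := by
    intro u hu
    have := coreU P T S hT hS hST hTS ℓ hℓ Λ hΛ hdom hY hX hX1 g₁ hg₁ hg₁0 g₂ hg₂ hg₂0 h3 (V u) (hVn u hu)
    filter_upwards [this] with ω h
    refine h.congr fun n => ?_
    rw [hVl, Finset.sum_sub_distrib, mul_sub]
  -- convergence of the conditional losses for the mean-optimal strategy
  obtain ⟨hutA, hutO⟩ := hut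
  set e : ℕ → Ω → ℝ := fun k => P[lossAt T S ℓ 0 (V ut k) | obsFieldLE T S Y 0] with he
  have hupper : ∀ w ∈ (Un T S Y 0 : Set (Ω → U)), ∀ᵐ ω ∂P, ∀ᶠ k : ℕ in atTop,
      e k ω ≤ (P[lossAt T S ℓ 0 w | obsFieldLE T S Y 0]) ω + (2 * g₃ k ω + (k:ℝ)⁻¹) := by
    intro w hw
    obtain ⟨j, hj⟩ := Un_exists hw
    have key : ∀ k : ℕ, max 1 j ≤ k → ∀ᵐ ω ∂P,
        e k ω ≤ (P[lossAt T S ℓ 0 w | obsFieldLE T S Y 0]) ω + (2 * g₃ k ω + (k:ℝ)⁻¹) := by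
      intro k hk
      have hk1 : 1 ≤ k := (le_max_left _ _).trans hk
      have hwk := hj k ((le_max_right _ _).trans hk)
      obtain ⟨g, hg, hle⟩ := hutO k hk1
      have a1 := hg.2.1 _ (shift_mem hST hTS k hwk)
      have a2 := condExp_shift hTp hSm hST hTS hY k (hi w hw)
      have a3 := condExp_shift (v := V ut k) hTp hSm hST hTS hY k (hi _ (hVn ut hutA k))
      rw [hVT ut k hk1] at a3
      have a4 : ∀ᵐ ω ∂P, (P[lossAt T S ℓ 0 (V ut k) | obsField T S Y (-(k:ℤ)) 0]) (T^[k] ω) ≤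
          (P[lossAt T S ℓ 0 w | obsField T S Y (-(k:ℤ)) 0]) (T^[k] ω) + (k:ℝ)⁻¹ := by
        filter_upwards [hle, a1, a2, a3] with ω b0 b1 b2 b3
        rw [← b2, ← b3]
        linarith
      have a5 := (hS.iterate k).quasiMeasurePreserving.ae a4
      filter_upwards [a5, (hg₃ k).2.1 w hwk, (hg₃ k).2.1 _ (hV ut hutA k)] with ω b1 b2 b3
      have hts : T^[k] (S^[k] ω) = ω := (Function.LeftInverse.iterate hTS k) ω
      rw [hts] at b1
      rw [abs_le] at b2 b3
      simp only [he]
      linarith [b2.1, b2.2, b3.1, b3.2]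
    have key' : ∀ᵐ ω ∂P, ∀ k : ℕ, max 1 j ≤ k →
        e k ω ≤ (P[lossAt T S ℓ 0 w | obsFieldLE T S Y 0]) ω + (2 * g₃ k ω + (k:ℝ)⁻¹) := by
      rw [ae_all_iff]
      intro k
      by_cases hk : max 1 j ≤ k
      · filter_upwards [key k hk] with ω h _ using h
      · exact ae_of_all _ fun ω h => absurd h hk
    filter_upwards [key'] with ω h
    filter_upwards [eventually_ge_atTop (max 1 j)] with k hk using h k hk
  have heb : ∀ᵐ ω ∂P, ∀ k, |e k ω| ≤ Λb ω := ae_all_iff.2 fun k => heΛ _ (hVn ut hutA k)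
  have hge : ∀ᵐ ω ∂P, ∀ k, ginf ω ≤ e k ω := ae_all_iff.2 fun k => hginf.2.1 _ (hVn ut hutA k)
  have hR : ∀ᵐ ω ∂P, limsup (fun k => e k ω) atTop ≤ ginf ω := by
    refine hginf.2.2 _ (Measurable.limsup fun k => hem _) ?_
    intro w hw
    filter_upwards [hupper w hw, heb, hg₃0] with ω b1 b2 b3
    have hlim : Tendsto (fun k : ℕ => (P[lossAt T S ℓ 0 w | obsFieldLE T S Y 0]) ω +
        (2 * g₃ k ω + (k:ℝ)⁻¹)) atTop (𝓝 ((P[lossAt T S ℓ 0 w | obsFieldLE T S Y 0]) ω + (2 * 0 + 0))) :=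
      ((b3.const_mul 2).add tendsto_natCast_atTop_atTop.inv_tendsto_atTop).const_add _
    rw [mul_zero, add_zero, add_zero] at hlim
    rw [← hlim.limsup_eq]
    refine limsup_le_limsup b1 ?_ hlim.isBoundedUnder_le
    exact (isBoundedUnder_of ⟨-Λb ω, fun k => (abs_le.1 (b2 k)).1⟩ :
      IsBoundedUnder (· ≥ ·) atTop fun k => e k ω).isCoboundedUnder_le
  have helim : ∀ᵐ ω ∂P, Tendsto (fun k => e k ω) atTop (𝓝 (ginf ω)) := by
    filter_upwards [hR, hge, heb] with ω b1 b2 b3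
    have u1 : IsBoundedUnder (· ≤ ·) atTop fun k => e k ω :=
      isBoundedUnder_of ⟨Λb ω, fun k => (abs_le.1 (b3 k)).2⟩
    have u2 : IsBoundedUnder (· ≥ ·) atTop fun k => e k ω :=
      isBoundedUnder_of ⟨-Λb ω, fun k => (abs_le.1 (b3 k)).1⟩
    refine tendsto_of_le_liminf_of_limsup_le ?_ b1 u1 u2
    exact le_liminf_of_le u1.isCoboundedUnder_ge (Eventually.of_forall b2)
  have hgi : Integrable ginf P := by
    refine hΛbi.mono' hginf.1.aestronglyMeasurable ?_
    filter_upwards [helim, heb] with ω b1 b2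
    exact le_of_tendsto' b1.abs b2
  have hconv : ∀ᵐ ω ∂P, Tendsto (fun n : ℕ => avgLoss T S ℓ ut n ω) atTop (𝓝 (∫ ω, ginf ω ∂P)) := by
    have hmk := maker hT (f := e) (fun k => hem _) hginf.1 hΛbi (fun k => heΛ _ (hVn ut hutA k)) helim
    filter_upwards [hmk, hA ut hutA] with ω b1 b2
    have := b2.add b1
    rw [zero_add] at this
    refine this.congr fun n => ?_
    simp only [he]
    ring
  refine ⟨hconv, hutA, ?_⟩
  intro u hu
  have c1 : ∀ᵐ ω ∂P, ∀ k, ginf (T^[k] ω) ≤ (P[lossAt T S ℓ 0 (V u k) | obsFieldLE T S Y 0]) (T^[k] ω) :=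
    ae_iterate hTp fun k => hginf.2.1 _ (hVn u hu k)
  have c2 : ∀ᵐ ω ∂P, ∀ k, |(P[lossAt T S ℓ 0 (V u k) | obsFieldLE T S Y 0]) (T^[k] ω)| ≤ Λb (T^[k] ω) :=
    ae_iterate (p := fun k ω => |(P[lossAt T S ℓ 0 (V u k) | obsFieldLE T S Y 0]) ω| ≤ Λb ω)
      hTp fun k => heΛ _ (hVn u hu k)
  filter_upwards [hconv, hA u hu, c1, c2, birk hT hgi, birk hT hΛbi] with ω b1 b2 b3 b4 b5 b6
  have lo := (b2.add b5).sub b1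
  have hi' := (b2.add b6).sub b1
  rw [zero_add, sub_self] at lo
  have hlo : ∀ n : ℕ, (avgLoss T S ℓ u n ω - (n:ℝ)⁻¹ * ∑ k ∈ Finset.Icc 1 n,
        (P[lossAt T S ℓ 0 (V u k) | obsFieldLE T S Y 0]) (T^[k] ω)) +
      (n:ℝ)⁻¹ * ∑ k ∈ Finset.Icc 1 n, ginf (T^[k] ω) - avgLoss T S ℓ ut n ω ≤
      avgLoss T S ℓ u n ω - avgLoss T S ℓ ut n ω := by
    intro n
    have : (n:ℝ)⁻¹ * ∑ k ∈ Finset.Icc 1 n, ginf (T^[k] ω) ≤ (n:ℝ)⁻¹ * ∑ k ∈ Finset.Icc 1 n,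
        (P[lossAt T S ℓ 0 (V u k) | obsFieldLE T S Y 0]) (T^[k] ω) := by
      gcongr with k hk
      exact b3 k
    linarith
  have hhi : ∀ n : ℕ, avgLoss T S ℓ u n ω - avgLoss T S ℓ ut n ω ≤
      (avgLoss T S ℓ u n ω - (n:ℝ)⁻¹ * ∑ k ∈ Finset.Icc 1 n,
        (P[lossAt T S ℓ 0 (V u k) | obsFieldLE T S Y 0]) (T^[k] ω)) +
      (n:ℝ)⁻¹ * ∑ k ∈ Finset.Icc 1 n, Λb (T^[k] ω) - avgLoss T S ℓ ut n ω := by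
    intro n
    have : (n:ℝ)⁻¹ * ∑ k ∈ Finset.Icc 1 n,
        (P[lossAt T S ℓ 0 (V u k) | obsFieldLE T S Y 0]) (T^[k] ω) ≤
        (n:ℝ)⁻¹ * ∑ k ∈ Finset.Icc 1 n, Λb (T^[k] ω) := by
      gcongr with k hk
      exact (abs_le.1 (b4 k)).2
    linarith
  have hbu : IsBoundedUnder (· ≤ ·) atTop fun n : ℕ =>
      avgLoss T S ℓ u n ω - avgLoss T S ℓ ut n ω :=
    hi'.isBoundedUnder_le.mono_le (Eventually.of_forall hhi)
  rw [← lo.liminf_eq]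
  exact liminf_le_liminf (Eventually.of_forall hlo) lo.isBoundedUnder_ge hbu.isCoboundedUnder_ge


/-- Corollary 2.7: under the strengthened uniform martingale convergence
assumptions and the conditional mixing assumption, every mean-optimal strategy `ũ` satisfies
`L_T(ũ) → L⋆` a.s. and is pathwise optimal. -/
theorem statement4
    {Ω U : Type*} [m0 : MeasurableSpace Ω] [MeasurableSpace U] [Nonempty U]
    (P : Measure Ω) [IsProbabilityMeasure P]
    (T S : Ω → Ω) (hT : Ergodic T P) (hS : MeasurePreserving S P P)
    (hST : Function.LeftInverse S T) (hTS : Function.RightInverse S T)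
    (ℓ : U → Ω → ℝ) (hℓ : Measurable fun p : U × Ω => ℓ p.1 p.2)
    (Λ : Ω → ℝ) (hΛ : Integrable Λ P) (hdom : ∀ u ω, |ℓ u ω| ≤ Λ ω)
    (Y : MeasurableSpace Ω) (hY : Y ≤ m0)
    (X : MeasurableSpace Ω) (hX : X ≤ m0) (hX1 : X ≤ MeasurableSpace.comap T X)
    (g₁ : ℕ → Ω → ℝ)
    (hg₁ : ∀ n : ℕ, IsEssSupFam P (Un T S Y 0 : Set (Ω → U))
      (fun v ω =>
        |(P[lossAt T S ℓ 0 v | obsFieldLE T S Y 0 ⊔ MeasurableSpace.comap (T^[n]) X]) ω -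
          lossAt T S ℓ 0 v ω|) (g₁ n))
    (hg₁0 : Tendsto (fun n : ℕ => ∫ ω, |g₁ n ω| ∂P) atTop (𝓝 0))
    (g₂ : ℕ → Ω → ℝ)
    (hg₂ : ∀ n : ℕ, IsEssSupFam P (Un T S Y 0 : Set (Ω → U))
      (fun v ω =>
        |(P[lossAt T S ℓ 0 v | obsFieldLE T S Y 0 ⊔ MeasurableSpace.comap (S^[n]) X]) ω -
          (P[lossAt T S ℓ 0 v | tailField T S Y X]) ω|) (g₂ n))
    (hg₂0 : Tendsto (fun n : ℕ => ∫ ω, |g₂ n ω| ∂P) atTop (𝓝 0))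
    (g₃ : ℕ → Ω → ℝ)
    (hg₃ : ∀ n : ℕ, IsEssSupFam P (Umn T S Y (-(n : ℤ)) 0 : Set (Ω → U))
      (fun v ω =>
        |(P[lossAt T S ℓ 0 v | obsField T S Y (-(n : ℤ)) 0]) ω -
          (P[lossAt T S ℓ 0 v | obsFieldLE T S Y 0]) ω|) (g₃ n))
    (hg₃0 : ∀ᵐ ω ∂P, Tendsto (fun n : ℕ => g₃ n ω) atTop (𝓝 0))
    (h3 : ∀ v ∈ (Un T S Y 0 : Set (Ω → U)),
      P[lossAt T S ℓ 0 v | obsFieldLE T S Y 0] =ᵐ[P]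
        P[lossAt T S ℓ 0 v | tailField T S Y X])
    (ginf : Ω → ℝ)
    (hginf : IsEssInfFam P (Un T S Y 0 : Set (Ω → U))
      (fun v => P[lossAt T S ℓ 0 v | obsFieldLE T S Y 0]) ginf)
    (ut : ℕ → Ω → U) (hut : MeanOptimalStrategy P T S Y ℓ ut) :
    (∀ᵐ ω ∂P, Tendsto (fun n : ℕ => avgLoss T S ℓ ut n ω) atTop (𝓝 (∫ ω, ginf ω ∂P))) ∧
      PathwiseOptimal P T S Y ℓ ut := by
  exact main_aux (m0 := m0) P T S hT hS hST hTS ℓ hℓ Λ hΛ hdom hY hX hX1 g₁ hg₁ hg₁0 g₂ hg₂ hg₂0 g₃ hg₃ hg₃0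
    h3 ginf hginf ut hut

end ErgodicDecisions
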